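/- arXiv:1503.06686 — 3 statements merged into one kernel-verified Lean document; each statement's English description precedes it below -/
import Mathlib

section
/- The elliptic curve over ℚ given by the Weierstrass equation y² = x³ − 675x − 1250 has infinitely many rational points, i.e., the set of ℚ-rational points of this Weierstrass curve is infinite. -/
/-- The Weierstrass curve `y² = x³ − 675x − 1250` over `ℚ`. -/
def W : WeierstrassCurve ℚ := { a₁ := 0, a₂ := 0, a₃ := 0, a₄ := -675, a₆ := -1250 }

lemma good_seq (n : ℕ) : ∃ (x y : ℚ) (a d : ℤ), y ≠ 0 ∧ y ^ 2 = x ^ 3 - 675 * x - 1250 ∧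
    Odd a ∧ Odd d ∧ x * (2 ^ (2 * n + 6) * d) = a := by
  induction n with
  | zero =>
    refine ⟨1881 / 64, 33571 / 512, 1881, 1, by norm_num, by norm_num, by decide, by decide, ?_⟩
    norm_num
  | succ n ih =>
    obtain ⟨x, y, a, d, hy, h, ha, hd, hx⟩ := ih
    obtain ⟨l, hl⟩ : ∃ l : ℚ, 2 * y * l = 3 * x ^ 2 - 675 :=
      ⟨(3 * x ^ 2 - 675) / (2 * y), by field_simp⟩
    obtain ⟨X, hX⟩ : ∃ X : ℚ, X = l ^ 2 - 2 * x := ⟨_, rfl⟩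
    obtain ⟨m, hm⟩ : ∃ m : ℤ, m = 2 ^ (2 * n + 5) * d := ⟨_, rfl⟩
    have hx' : x * (2 * m) = a := by
      rw [← hx, hm]; push_cast; ring
    have hq : 4 * y ^ 2 * X = x ^ 4 + 1350 * x ^ 2 + 10000 * x + 455625 := by
      rw [hX]
      linear_combination (2 * y * l + 3 * x ^ 2 - 675) * hl - 8 * x * h
    have hA : Odd (a ^ 4 + 1350 * a ^ 2 * (2 * m) ^ 2 + 10000 * a * (2 * m) ^ 3
        + 455625 * (2 * m) ^ 4) := by
      have h4 : Odd (a ^ 4) := ha.pow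
      obtain ⟨t, ht⟩ := h4
      exact ⟨t + 675 * a ^ 2 * (2 * m) ^ 2 + 5000 * a * (2 * m) ^ 3 + 455625 * 8 * m ^ 4, by
        rw [ht]; ring⟩
    have hB : Odd (a ^ 3 - 675 * a * (2 * m) ^ 2 - 1250 * (2 * m) ^ 3) := by
      have h3 : Odd (a ^ 3) := ha.pow
      obtain ⟨t, ht⟩ := h3
      exact ⟨t - 675 * a * 2 * m ^ 2 - 625 * (2 * m) ^ 3, by rw [ht]; ring⟩
    have hE : (y + l * (X - x)) ^ 2 = X ^ 3 - 675 * X - 1250 := by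
      linear_combination h + (X - x) * hl - (X - x) ^ 2 * hX
    have hXd : X * (2 ^ (2 * (n + 1) + 6) * ((d * (a ^ 3 - 675 * a * (2 * m) ^ 2
        - 1250 * (2 * m) ^ 3) : ℤ) : ℚ)) = ((a ^ 4 + 1350 * a ^ 2 * (2 * m) ^ 2
          + 10000 * a * (2 * m) ^ 3 + 455625 * (2 * m) ^ 4 : ℤ) : ℚ) := by
      have e : (2 : ℚ) ^ (2 * (n + 1) + 6) * d = 4 * (2 * m) := by
        rw [hm]; push_cast; ring
      push_cast
      rw [← mul_assoc (2 ^ (2 * (n + 1) + 6) : ℚ), e, ← hx']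
      linear_combination (2 * (m : ℚ)) ^ 4 * hq - 4 * X * (2 * (m : ℚ)) ^ 4 * h
    refine ⟨X, y + l * (X - x), _, _, ?_, hE, hA, hd.mul hB, hXd⟩
    intro h0
    rw [h0] at hE
    generalize d * (a ^ 3 - 675 * a * (2 * m) ^ 2 - 1250 * (2 * m) ^ 3) = D at hXd
    generalize (a ^ 4 + 1350 * a ^ 2 * (2 * m) ^ 2
          + 10000 * a * (2 * m) ^ 3 + 455625 * (2 * m) ^ 4) = A at hXd hA
    have hz : A ^ 3 = 675 * A * (2 ^ (2 * (n + 1) + 6) * D) ^ 2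
        + 1250 * (2 ^ (2 * (n + 1) + 6) * D) ^ 3 := by
      have : (A : ℚ) ^ 3 = 675 * A * (2 ^ (2 * (n + 1) + 6) * D) ^ 2
        + 1250 * (2 ^ (2 * (n + 1) + 6) * D) ^ 3 := by
        rw [← hXd]
        linear_combination -((2 : ℚ) ^ (2 * (n + 1) + 6) * D) ^ 3 * hE
      exact_mod_cast this
    have h3 : Odd (A ^ 3) := hA.pow
    rw [hz, pow_succ (2 : ℤ)] at h3
    generalize (2 : ℤ) ^ (2 * (n + 1) + 5) = z at h3
    rw [← Int.not_even_iff_odd] at h3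
    apply h3
    exact ⟨675 * A * 2 * (z * D) ^ 2 + 1250 * 4 * (z * D) ^ 3, by ring⟩

lemma val_lt {x : ℚ} {a d b e : ℤ} {k l : ℕ} (hkl : k < l) (ha : Odd a) (he : Odd e) (hd : Odd d)
    (hb : Odd b) (h1 : x * (2 ^ k * d) = a) (h2 : x * (2 ^ l * e) = b) : False := by
  obtain ⟨t, rfl⟩ := Nat.exists_eq_add_of_lt hkl
  have : (b * d : ℚ) = a * (2 ^ (t + 1) * e) := by
    rw [← h1, ← h2]; ring
  have h : b * d = a * (2 ^ (t + 1) * e) := by exact_mod_cast this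
  have ho := hb.mul hd
  rw [h, ← Int.not_even_iff_odd] at ho
  exact ho ⟨a * (2 ^ t * e), by ring⟩

/-- The elliptic curve `y² = x³ − 675x − 1250` has infinitely many rational points. -/
theorem hurwitz_curve_infinitely_many_points : Infinite W.toAffine.Point := by
  choose x y a d hy h ha hd hx using good_seq
  have hn : ∀ n, W.toAffine.Nonsingular (x n) (y n) := by
    intro n
    rw [WeierstrassCurve.Affine.nonsingular_iff, WeierstrassCurve.Affine.equation_iff]
    refine ⟨?_, Or.inr ?_⟩
    · simp only [W]
      linear_combination h n
    · simp only [W]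
      intro h0
      apply hy n
      linarith
  refine Infinite.of_injective (fun n => WeierstrassCurve.Affine.Point.some _ _ (hn n)) ?_
  intro i j hij
  have hxx : x i = x j := by
    simp only [WeierstrassCurve.Affine.Point.some.injEq] at hij
    exact hij.1
  have hj := hx j
  rw [← hxx] at hj
  rcases lt_trichotomy i j with hlt | heq | hlt
  · exact (val_lt (by omega) (ha i) (hd j) (hd i) (ha j) (hx i) hj).elim
  · exact heq
  · exact (val_lt (by omega) (ha j) (hd i) (hd j) (ha i) hj (hx i)).elim
end

section
/- Let f₄(x) = (x² − x − 1)⁵·(x² − x − 1/16) − (5⁴/2⁵)·x³·(x − 1)³·(x³ − 2) ∈ ℚ[x]. Then f₄ is irreducible over ℚ and the Galois group of its splitting field over ℚ is a simple group of cardinality 7920 (i.e., isomorphic to the Mathieu group M₁₁). -/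
open Polynomial

/-- `f₄(x) = (x² − x − 1)⁵ (x² − x − 1/16) − (5⁴/2⁵) · x³ (x − 1)³ (x³ − 2)` over `ℚ`. -/
noncomputable def f4 : Polynomial ℚ :=
  (X ^ 2 - X - 1) ^ 5 * (X ^ 2 - X - C (1 / 16 : ℚ)) -
    C (5 ^ 4 / 2 ^ 5 : ℚ) * (X ^ 3 * (X - 1) ^ 3 * (X ^ 3 - 2))

namespace M11P
section lists
variable {A : Type*} [CommRing A]

def ev (x : A) : List ℤ → A
  | [] => 0
  | c :: l => (c : A) + x * ev x l

def em (x : A) (r : List ℤ) : A := x ^ r.length + ev x r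

def ladd (p : ℤ) : List ℤ → List ℤ → List ℤ
  | [], l => l
  | a :: l, [] => a :: l
  | a :: l, b :: m => ((a + b) % p) :: ladd p l m

def lsm (p c : ℤ) (l : List ℤ) : List ℤ := l.map fun a => (c * a) % p

def mulX (p : ℤ) (r l : List ℤ) : List ℤ :=
  match (0 :: l).drop r.length with
  | [t] => ladd p ((0 :: l).take r.length) (lsm p (-t) r)
  | _ => 0 :: l

def lmul (p : ℤ) (r : List ℤ) (a b : List ℤ) : List ℤ :=
  a.foldr (fun c acc => ladd p (lsm p c b) (mulX p r acc)) []

def pmul (p : ℤ) (a b : List ℤ) : List ℤ :=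
  a.foldr (fun c acc => ladd p (lsm p c b) (0 :: acc)) []

def lsub (p : ℤ) (a b : List ℤ) : List ℤ := ladd p a (lsm p (-1) b)

def lz (p : ℤ) (a : List ℤ) : Bool := a.all fun c => c % p == 0

def lpw (p : ℤ) (r a : List ℤ) : List Bool → List ℤ
  | [] => [1]
  | b :: l => let s := lpw p r a l
    let q := lmul p r s s
    if b then lmul p r q a else q

def bval : List Bool → ℕ
  | [] => 0
  | b :: l => bval l + bval l + (if b then 1 else 0)

def hor (p : ℤ) (r : List ℤ) (a : List ℤ) (l : List ℤ) : List ℤ :=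
  l.foldr (fun c acc => ladd p [c] (lmul p r a acc)) []

def ev2 (x y : A) : List (List ℤ) → A
  | [] => 0
  | c :: l => ev y c + x * ev2 x y l

def add2 (p : ℤ) : List (List ℤ) → List (List ℤ) → List (List ℤ)
  | [], l => l
  | a :: l, [] => a :: l
  | a :: l, b :: m => ladd p a b :: add2 p l m

def mul2 (p : ℤ) (r : List ℤ) (a b : List (List ℤ)) : List (List ℤ) :=
  a.foldr (fun c acc => add2 p (b.map (lmul p r c)) ([] :: acc)) []

def hor2 (p : ℤ) (r : List ℤ) (a : List ℤ) (l : List (List ℤ)) : List ℤ :=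
  l.foldr (fun c acc => ladd p c (lmul p r a acc)) []

theorem cmod (p : ℤ) (hp : (p : A) = 0) (a : ℤ) : ((a % p : ℤ) : A) = a := by
  rw [Int.emod_def]; push_cast; rw [hp]; ring

theorem ev_add (p : ℤ) (hp : (p : A) = 0) (x : A) (a b : List ℤ) :
    ev x (ladd p a b) = ev x a + ev x b := by
  induction a generalizing b with
  | nil => simp [ladd, ev]
  | cons c l ih =>
    cases b with
    | nil => simp [ladd, ev]
    | cons d m => simp only [ladd, ev, cmod p hp, ih]; push_cast; ring

theorem ev_sm (p : ℤ) (hp : (p : A) = 0) (x : A) (c : ℤ) (a : List ℤ) :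
    ev x (lsm p c a) = c * ev x a := by
  induction a with
  | nil => simp [lsm, ev]
  | cons d l ih =>
    have : lsm p c (d :: l) = ((c * d) % p) :: lsm p c l := rfl
    rw [this]; simp only [ev, cmod p hp, ih]; push_cast; ring

theorem ev_take (x : A) (n : ℕ) (a : List ℤ) :
    ev x a = ev x (a.take n) + x ^ n * ev x (a.drop n) := by
  induction n generalizing a with
  | zero => simp [ev]
  | succ n ih =>
    cases a with
    | nil => simp [ev]
    | cons d l => simp only [List.take_succ_cons, List.drop_succ_cons, ev]; rw [ih l]; ring

theorem ev_mulX (p : ℤ) (hp : (p : A) = 0) (x : A) (r : List ℤ) (hr : em x r = 0) (a : List ℤ) :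
    ev x (mulX p r a) = x * ev x a := by
  have h0 : x * ev x a = ev x (0 :: a) := by simp [ev]
  rw [h0]
  unfold mulX
  split
  · next t ht =>
    rw [ev_add p hp, ev_sm p hp, ev_take x r.length (0 :: a), ht]
    simp only [ev, em] at *
    push_cast
    linear_combination (-(t : A)) * hr
  · rfl

theorem ev_mul (p : ℤ) (hp : (p : A) = 0) (x : A) (r : List ℤ) (hr : em x r = 0) (a b : List ℤ) :
    ev x (lmul p r a b) = ev x a * ev x b := by
  induction a with
  | nil => simp [lmul, ev]
  | cons c l ih =>
    have : lmul p r (c :: l) b = ladd p (lsm p c b) (mulX p r (lmul p r l b)) := rfl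
    rw [this, ev_add p hp, ev_sm p hp, ev_mulX p hp x r hr, ih]; simp only [ev]; ring

theorem ev_pmul (p : ℤ) (hp : (p : A) = 0) (x : A) (a b : List ℤ) :
    ev x (pmul p a b) = ev x a * ev x b := by
  induction a with
  | nil => simp [pmul, ev]
  | cons c l ih =>
    have : pmul p (c :: l) b = ladd p (lsm p c b) (0 :: (pmul p l b)) := rfl
    rw [this, ev_add p hp, ev_sm p hp]; simp only [ev]; rw [ih]; push_cast; ring

theorem ev_sub (p : ℤ) (hp : (p : A) = 0) (x : A) (a b : List ℤ) :
    ev x (lsub p a b) = ev x a - ev x b := by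
  rw [lsub, ev_add p hp, ev_sm p hp]; push_cast; ring

theorem ev_lz (p : ℤ) (hp : (p : A) = 0) (x : A) (a : List ℤ) (h : lz p a = true) : ev x a = 0 := by
  induction a with
  | nil => rfl
  | cons c l ih =>
    simp only [lz, List.all_cons, Bool.and_eq_true, beq_iff_eq] at h
    simp only [ev]
    rw [ih h.2, ← cmod p hp c, h.1]; simp

theorem ev_append_one (x : A) (r : List ℤ) : ev x (r ++ [1]) = em x r := by
  rw [ev_take x r.length]; simp [ev, em]; ring

theorem ev_pw (p : ℤ) (hp : (p : A) = 0) (x : A) (r : List ℤ) (hr : em x r = 0) (a : List ℤ)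
    (l : List Bool) : ev x (lpw p r a l) = ev x a ^ bval l := by
  induction l with
  | nil => simp [lpw, bval, ev]
  | cons b l ih =>
    simp only [lpw, bval]
    split
    · simp only [ev_mul p hp x r hr, ih]; ring
    · simp only [ev_mul p hp x r hr, ih]; ring

theorem ev_hor (p : ℤ) (hp : (p : A) = 0) (x : A) (r : List ℤ) (hr : em x r = 0) (a l : List ℤ) :
    ev x (hor p r a l) = ev (ev x a) l := by
  induction l with
  | nil => rfl
  | cons c l ih =>
    have : hor p r a (c :: l) = ladd p [c] (lmul p r a (hor p r a l)) := rfl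
    rw [this, ev_add p hp, ev_mul p hp x r hr, ih]; simp only [ev]; ring

theorem ev2_add (p : ℤ) (hp : (p : A) = 0) (x y : A) (a b : List (List ℤ)) :
    ev2 x y (add2 p a b) = ev2 x y a + ev2 x y b := by
  induction a generalizing b with
  | nil => simp [add2, ev2]
  | cons c l ih =>
    cases b with
    | nil => simp [add2, ev2]
    | cons d m => simp only [add2, ev2, ev_add p hp, ih]; ring

theorem ev2_map (p : ℤ) (hp : (p : A) = 0) (x y : A) (r : List ℤ) (hr : em y r = 0) (c : List ℤ)
    (b : List (List ℤ)) : ev2 x y (b.map (lmul p r c)) = ev y c * ev2 x y b := by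
  induction b with
  | nil => simp [ev2]
  | cons d l ih => simp only [List.map_cons, ev2, ev_mul p hp y r hr, ih]; ring

theorem ev2_mul (p : ℤ) (hp : (p : A) = 0) (x y : A) (r : List ℤ) (hr : em y r = 0)
    (a b : List (List ℤ)) : ev2 x y (mul2 p r a b) = ev2 x y a * ev2 x y b := by
  induction a with
  | nil => simp [mul2, ev2]
  | cons c l ih =>
    have : mul2 p r (c :: l) b = add2 p (b.map (lmul p r c)) ([] :: (mul2 p r l b)) := rfl
    rw [this, ev2_add p hp, ev2_map p hp x y r hr]; simp only [ev2, ih, ev]; ring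

theorem ev2_lz (p : ℤ) (hp : (p : A) = 0) (x y : A) (a : List (List ℤ))
    (h : (a.all fun c => lz p c) = true) : ev2 x y a = 0 := by
  induction a with
  | nil => rfl
  | cons c l ih =>
    simp only [List.all_cons, Bool.and_eq_true] at h
    simp only [ev2]
    rw [ih h.2, ev_lz p hp y c h.1]; simp

theorem ev2_const (x y : A) (a : List ℤ) : ev2 x y (a.map fun c => [c]) = ev x a := by
  induction a with
  | nil => rfl
  | cons c l ih => simp only [List.map_cons, ev2, ev, ih]; ring

/-- evaluating at list-represented second variable -/
theorem ev_map_hor2 (p : ℤ) (hp : (p : A) = 0) (x : A) (r : List ℤ) (hr : em x r = 0)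
    (z y : List ℤ) (L : List (List ℤ)) :
    ev x (hor2 p r z (L.map (hor p r y))) = ev2 (ev x z) (ev x y) L := by
  induction L with
  | nil => rfl
  | cons c l ih =>
    have : hor2 p r z ((c :: l).map (hor p r y)) =
      ladd p (hor p r y c) (lmul p r z (hor2 p r z (l.map (hor p r y)))) := rfl
    rw [this, ev_add p hp, ev_mul p hp x r hr, ih, ev_hor p hp x r hr]; simp only [ev2]

variable {B : Type*} [CommRing B]
theorem map_ev (θ : A →+* B) (x : A) (l : List ℤ) : θ (ev x l) = ev (θ x) l := by
  induction l with
  | nil => simp [ev]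
  | cons c l ih => simp [ev, ih]
theorem map_em (θ : A →+* B) (x : A) (l : List ℤ) : θ (em x l) = em (θ x) l := by
  simp [em, map_ev]
theorem map_ev2 (θ : A →+* B) (x y : A) (l : List (List ℤ)) : θ (ev2 x y l) = ev2 (θ x) (θ y) l := by
  induction l with
  | nil => simp [ev2]
  | cons c l ih => simp [ev2, ih, map_ev]
end lists
def FL : List ℤ := [1048576, 5505024, 4521984, -10403840, 6635520, -1990656, 350336, -56544, 8520, -910, 159, -24]
def RL : List ℤ := [-54419558400000000, 1793179036800000000, 262394539975000000, 29561869878750000, -7810764846187500, 125167640840625, -1198585338750, 8414049375, -44160000, 201375, -630]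
def RL22 : List ℤ := [-54419558400000000, 0, 1793179036800000000, 0, 262394539975000000, 0, 29561869878750000, 0, -7810764846187500, 0, 125167640840625, 0, -1198585338750, 0, 8414049375, 0, -44160000, 0, 201375, 0, -630, 0]
def GLs : List (List ℤ) := [[7785782324055244800000000, 1152471086538854400000000, 133175549067402240000000, -43181753253320448000000, 720326526105024000000, -7041894893429760000, 50750918945280000, -269073100800000, 1235741184000, -3865190400, 6156288],
  [-528151246995456000000000, -31961706823065600000000, -21656822489435520000000, 9561339480032064000000, -155374499867832000000, 1103110414750080000, -5884305756480000, 20306661120000, -80315712000, 346291200, -843264],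
  [111728106036633600000000, -4216161926620800000000, 11791333077267600000000, -3724236388030320000000, 75479935248693000000, -556904171890800000, 2821999587480000, -7486693920000, 2886840000, 1296000, 60480],
  [-46040870742451200000000, -17662724105238000000000, -1946139358205700000000, 741519857593935000000, -22858973921013750000, 229786452382500000, -1525626602730000, 6915337200000, -20140650000, 48276000, -65520],
  [989866824998400000000, -362158350075000000000, -37125601748325000000, -25385070592845000000, 2306265371508937500, -30919626919125000, 247550467612500, -1402394310000, 5747962500, -17901000, 28620],
  [-1549306687795200000000, -453417765076800000000, -76624366725720000000, 26994003308424000000, -540724208431500000, 6213466396080000, -50888170620000, 305233920000, -1565892000, 5443200, -9504],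
  [129108890649600000000, 37784813756400000000, 6385363893810000000, -2249500275702000000, 45060350702625000, -517788866340000, 4240680885000, -25436160000, 130491000, -453600, 792]]
def HLs : List (List ℤ) := [[-44791797525597388800000000, -6412322020776985600000000, -721757006388967680000000, 194435773707843648000000, -3118566497390371200000, 29873035676448000000, -209838037714560000, 1101680609280000, -5025969792000, 15728486400, -24976384],
  [3069401746732646400000000, 314257656600844800000000, 38346080434326720000000, -12653885023579008000000, 206686592908466400000, -1974297366498240000, 13794476355360000, -71549089920000, 323269920000, -1012262400, 1616640],
  [-609623115052723200000000, -65398328471202000000000, -5007140857282140000000, 2396745377631981000000, -41775274680061050000, 406481296429980000, -2840859670950000, 14713876080000, -64943910000, 199864800, -312720],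
  [203759176770403200000000, 29420227173987650000000, 1666273686382642500000, -683653997294222625000, 11970355929975318750, -119156067938722500, 853746158981250, -4574721000000, 20643941250, -63638100, 98750],
  [31068826447896000000000, 5383921633178625000000, 470923835974908750000, -148481947701860062500, 2263395314575378125, -20743269073548750, 139769674891875, -699429195000, 3110551875, -9602550, 15165],
  [129108890649600000000, 37784813756400000000, 6385363893810000000, -2249500275702000000, 45060350702625000, -517788866340000, 4240680885000, -25436160000, 130491000, -453600, 792]]
def DL : List ℤ := [64554445324800000000, 18892406878200000000, 3192681946905000000, -1124750137851000000, 22530175351312500, -258894433170000, 2120340442500, -12718080000, 65245500, -226800, 396]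
def f59 : List ℤ := [42, 10, 26, 55, 45, 27, 39, 56, 11, 5, 54]
def g59 : List ℤ := [40, 1]
def V59 : List ℤ := [42, 53, 47, 30, 57, 23, 7, 38, 49, 25, 48]
def i59 : List ℤ := [38, 42, 4, 51, 4, 28, 26, 9, 2, 56, 3]
def j59 : List ℤ := [27, 39, 40, 31, 40, 0, 23, 30, 7, 50, 56]
def f7 : List ℤ := [3, 3, 1, 0, 5, 3, 2, 5]
def g7 : List ℤ := [6, 1, 1, 6, 1]
def i7 : List ℤ := [3, 6, 5, 2, 6, 3, 0, 3]
def f53 : List ℤ := [50, 37, 9, 37, 1]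
def g53 : List ℤ := [45, 36, 41, 18, 18, 41, 28, 1]
def i53 : List ℤ := [23, 14, 32, 1, 18]
def f11 : List ℤ := [10, 9, 9]
def g11 : List ℤ := [10, 5, 9, 0, 8, 1, 7, 7, 0, 1]
def i11 : List ℤ := [4, 2, 10]
def Z59 : List (List ℤ) := [[0, 1, 0, 0, 0, 0, 0, 0, 0, 0, 0],
  [55, 40, 54, 13, 16, 4, 19, 38, 34, 39, 54],
  [42, 52, 56, 49, 39, 19, 55, 38, 20, 3, 17],
  [57, 35, 48, 20, 48, 48, 52, 12, 5, 42, 55],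
  [18, 4, 42, 45, 9, 4, 47, 55, 4, 8, 36],
  [21, 26, 13, 51, 51, 32, 37, 38, 14, 33, 31],
  [20, 43, 56, 32, 51, 46, 7, 28, 52, 48, 20],
  [55, 3, 55, 30, 48, 1, 15, 18, 21, 52, 5],
  [38, 6, 45, 20, 47, 18, 4, 12, 50, 27, 42],
  [36, 19, 32, 18, 55, 7, 15, 55, 12, 30, 12],
  [17, 7, 12, 17, 49, 57, 44, 1, 24, 13, 23]]
def Y59 : List ℤ := [8, 12, 55, 41, 58, 35, 35, 1, 53, 58, 33]
def W59 : List (List ℤ) := [[43, 41, 51, 7, 38, 32, 18, 10, 18, 55, 49],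
  [45, 2, 27, 0, 3, 32, 2, 6, 15, 50, 39],
  [25, 7, 52, 58, 22, 36, 14, 22, 31, 10, 32],
  [52, 17, 23, 29, 15, 30, 18, 57, 41, 30, 43],
  [34, 53, 56, 17, 51, 27, 12, 53, 46, 8, 31],
  [27, 54, 33, 20, 39, 5, 7, 40, 31, 16, 47],
  [52, 14, 58, 38, 15, 54, 14, 29, 14, 32, 51]]
def itf (p : ℤ) (r : List ℤ) (bs : List Bool) : ℕ → List ℤ
  | 0 => [0, 1]
  | n + 1 => lpw p r (itf p r bs n) bs

def b59 : List Bool := [true, true, false, true, true, true]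
def b53 : List Bool := [true, false, true, false, true, true]
def b11 : List Bool := [true, true, false, true]
def b7 : List Bool := [true, true, true]

def okPer (p : ℤ) (r i : List ℤ) (bs : List Bool) (n m : ℕ) : Bool :=
  lz p (lsub p (itf p r bs n) [0, 1]) &&
  lz p (lsub p (lmul p r i (lsub p (itf p r bs m) [0, 1])) [1])

theorem pc7 : okPer 7 f7 i7 b7 8 4 = true := by decide +kernel
theorem pc53 : okPer 53 f53 i53 b53 5 1 = true := by decide +kernel
theorem pc11 : okPer 11 f11 i11 b11 3 1 = true := by decide +kernel

def okF (p : ℤ) (f g : List ℤ) : Bool := lz p (lsub p (pmul p (f ++ [1]) g) (FL ++ [1]))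
theorem oF7 : okF 7 f7 g7 = true := by decide +kernel
theorem oF11 : okF 11 f11 g11 = true := by decide +kernel
theorem oF53 : okF 53 f53 g53 = true := by decide +kernel
theorem oF59 : okF 59 f59 g59 = true := by decide +kernel
theorem oV59 : lz 59 (ladd 59 (lmul 59 f59 (lpw 59 f59 V59 [true, true, false, true]) (lpw 59 f59 V59 [true, true, false, true]) ) (hor 59 f59 V59 RL22)) = true := by
  decide +kernel
theorem okC1 : lz 59 (lsub 59 (lmul 59 f59 V59 V59) Y59) = true := by decide +kernel
theorem okC2 : (add2 59 (add2 59 (GLs.map (hor 59 f59 Y59)) ((HLs.map (hor 59 f59 Y59)).map (lmul 59 f59 V59))) (W59.map (lsm 59 (-1)))).all (lz 59) = true := by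
  decide +kernel
theorem okC3 : lz 59 (lsub 59 (lmul 59 f59 (([0, 2, 6, 7, 8, 10] : List ℕ).foldr (fun i acc => lmul 59 f59 (hor2 59 f59 (Z59.getD i []) W59) acc) (hor 59 f59 Y59 DL)) j59) [1]) = true := by
  decide +kernel
theorem okC4 : ((List.range 11).all fun i => lz 59 (lsub 59 (lpw 59 f59 (Z59.getD i []) b59) (Z59.getD ((i+1)%11) []))) = true := by
  decide +kernel
theorem okC5 : lz 59 (lsub 59 (lmul 59 f59 i59 (lsub 59 (Z59.getD 1 []) [0, 1])) [1]) = true := by decide +kernel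
theorem okC6 : (add2 0 (mul2 0 RL GLs GLs) (add2 0 ((mul2 0 RL HLs HLs).map (lmul 0 RL [0, -1]))
  (mul2 0 RL [lsm 0 (-4) (lmul 0 RL DL DL)] ((FL ++ [1]).map fun c => [c])))).all (lz 0) = true := by
  decide +kernel
section sem
variable {A : Type*} [CommRing A]

theorem itf_sem (p : ℤ) (hp : (p : A) = 0) (r : List ℤ) (bs : List Bool) (x : A) (hx : em x r = 0)
    (n : ℕ) : ev x (itf p r bs n) = x ^ (bval bs ^ n) := by
  induction n with
  | zero => simp [itf, ev]
  | succ n ih => rw [itf, ev_pw p hp x r hx, ih, ← pow_mul, pow_succ]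

theorem okPer_sem [Nontrivial A] (p : ℤ) (hp : (p : A) = 0) (r i : List ℤ) (bs : List Bool) (n m : ℕ)
    (h : okPer p r i bs n m = true) (x : A) (hx : em x r = 0) :
    x ^ (bval bs ^ n) = x ∧ x ^ (bval bs ^ m) ≠ x := by
  simp only [okPer, Bool.and_eq_true] at h
  have h1 := ev_lz p hp x _ h.1
  have h2 := ev_lz p hp x _ h.2
  rw [ev_sub p hp, itf_sem p hp r bs x hx] at h1
  rw [ev_sub p hp, ev_mul p hp x r hx, ev_sub p hp, itf_sem p hp r bs x hx] at h2
  simp only [ev] at h1 h2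
  refine ⟨by linear_combination h1, fun h3 => ?_⟩
  rw [h3] at h2
  apply one_ne_zero (α := A)
  push_cast at h2
  linear_combination -h2

theorem okF_sem (p : ℤ) (hp : (p : A) = 0) (f g : List ℤ) (h : okF p f g = true) (x : A) :
    em x FL = em x f * ev x g := by
  have h1 := ev_lz p hp x _ h
  rw [ev_sub p hp, ev_pmul p hp, ev_append_one, ev_append_one] at h1
  linear_combination -h1

theorem V_sem (hp : ((59 : ℤ) : A) = 0) (x : A) (hx : em x f59 = 0) : em (ev x V59) RL22 = 0 := by
  have h1 := ev_lz 59 hp x _ oV59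
  rw [ev_add 59 hp, ev_mul 59 hp x f59 hx, ev_hor 59 hp x f59 hx, ev_pw 59 hp x f59 hx,
    ← pow_add] at h1
  exact h1

def WW (x v : A) : A := ev2 x (v ^ 2) GLs + v * ev2 x (v ^ 2) HLs

theorem WW_ident (x v : A) (hv : em (v ^ 2) RL = 0) :
    WW x v * WW x (-v) = 4 * ev (v ^ 2) DL ^ 2 * em x FL := by
  have h0 : ((0 : ℤ) : A) = 0 := by simp
  have h1 := ev2_lz 0 h0 x (v ^ 2) _ okC6
  rw [ev2_add 0 h0, ev2_add 0 h0, ev2_map 0 h0 _ _ RL hv, ev2_mul 0 h0 _ _ RL hv,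
    ev2_mul 0 h0 _ _ RL hv, ev2_mul 0 h0 _ _ RL hv, ev2_const, ev_append_one] at h1
  simp only [ev2] at h1
  rw [ev_sm 0 h0, ev_mul 0 h0 _ RL hv] at h1
  simp only [ev] at h1
  simp only [WW, neg_sq]
  push_cast at h1
  linear_combination h1

theorem RL22_eq (v : A) : em v RL22 = em (v ^ 2) RL := by
  simp only [em, ev, RL, RL22, List.length]; ring

theorem Z_sem (hp : ((59 : ℤ) : A) = 0) (x : A) (hx : em x f59 = 0) (i : ℕ) (hi : i < 11) :
    ev x (Z59.getD i []) = x ^ (59 ^ i) := by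
  induction i with
  | zero => simp [Z59, ev]
  | succ n ih =>
    have h1 := List.all_eq_true.mp okC4 n (List.mem_range.mpr (by lia))
    have h2 := ev_lz 59 hp x _ h1
    rw [ev_sub 59 hp, ev_pw 59 hp x f59 hx, ih (by lia), Nat.mod_eq_of_lt hi] at h2
    rw [pow_succ, pow_mul]
    exact (sub_eq_zero.mp h2).symm

theorem Z_sem' (hp : ((59 : ℤ) : A) = 0) (x : A) (hx : em x f59 = 0) : x ^ (59 ^ 11) = x := by
  have h1 := List.all_eq_true.mp okC4 10 (List.mem_range.mpr (by lia))
  have h2 := ev_lz 59 hp x _ h1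
  rw [ev_sub 59 hp, ev_pw 59 hp x f59 hx, Z_sem hp x hx 10 (by lia)] at h2
  have h3 : ev x (Z59.getD ((10 + 1) % 11) []) = x := by simp [Z59, ev]
  rw [h3, ← pow_mul] at h2
  exact sub_eq_zero.mp h2

theorem Z_ne [Nontrivial A] (hp : ((59 : ℤ) : A) = 0) (x : A) (hx : em x f59 = 0) : x ^ 59 ≠ x := by
  intro h
  have h2 := ev_lz 59 hp x _ okC5
  rw [ev_sub 59 hp, ev_mul 59 hp x f59 hx, ev_sub 59 hp, Z_sem hp x hx 1 (by lia), pow_one, h] at h2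
  simp only [ev] at h2
  apply one_ne_zero (α := A)
  push_cast at h2
  linear_combination -h2

theorem ev_hor2 (p : ℤ) (hp : (p : A) = 0) (x : A) (r : List ℤ) (hr : em x r = 0) (z : List ℤ)
    (L : List (List ℤ)) : ev x (hor2 p r z L) = ev2 (ev x z) x L := by
  induction L with
  | nil => rfl
  | cons c l ih =>
    have : hor2 p r z (c :: l) = ladd p c (lmul p r z (hor2 p r z l)) := rfl
    rw [this, ev_add p hp, ev_mul p hp x r hr, ih]; simp only [ev2]

theorem ev2_map_hor (p : ℤ) (hp : (p : A) = 0) (x : A) (r : List ℤ) (hr : em x r = 0) (z : A)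
    (y : List ℤ) (L : List (List ℤ)) : ev2 z x (L.map (hor p r y)) = ev2 z (ev x y) L := by
  induction L with
  | nil => rfl
  | cons c l ih => simp only [List.map_cons, ev2, ev_hor p hp x r hr, ih]

theorem ev2_sm (p : ℤ) (hp : (p : A) = 0) (x y : A) (c : ℤ) (b : List (List ℤ)) :
    ev2 x y (b.map (lsm p c)) = c * ev2 x y b := by
  induction b with
  | nil => simp [ev2]
  | cons d l ih => simp only [List.map_cons, ev2, ev_sm p hp, ih]; ring

theorem W_sem (hp : ((59 : ℤ) : A) = 0) (x : A) (hx : em x f59 = 0) (z : A) :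
    ev2 z x W59 = WW z (ev x V59) := by
  have h1 := ev_lz 59 hp x _ okC1
  rw [ev_sub 59 hp, ev_mul 59 hp x f59 hx] at h1
  have hy : ev x V59 ^ 2 = ev x Y59 := by linear_combination h1
  have h2 := ev2_lz 59 hp z x _ okC2
  rw [ev2_add 59 hp, ev2_add 59 hp, ev2_map_hor 59 hp x f59 hx, ev2_map 59 hp z x f59 hx,
    ev2_map_hor 59 hp x f59 hx, ev2_sm 59 hp] at h2
  rw [WW, hy]
  push_cast at h2
  linear_combination -h2

theorem WD_sem [Nontrivial A] (hp : ((59 : ℤ) : A) = 0) (x : A) (hx : em x f59 = 0) :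
    ev (ev x V59 ^ 2) DL ≠ 0 ∧
    ∀ i ∈ ([0, 2, 6, 7, 8, 10] : List ℕ), WW (x ^ (59 ^ i)) (ev x V59) ≠ 0 := by
  have h1 := ev_lz 59 hp x _ okC1
  rw [ev_sub 59 hp, ev_mul 59 hp x f59 hx] at h1
  have hy : ev x V59 ^ 2 = ev x Y59 := by linear_combination h1
  have h3 := ev_lz 59 hp x _ okC3
  rw [ev_sub 59 hp, ev_mul 59 hp x f59 hx] at h3
  have key : ∀ l : List ℕ, (∀ i ∈ l, i < 11) →
      ev x (l.foldr (fun i acc => lmul 59 f59 (hor2 59 f59 (Z59.getD i []) W59) acc)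
        (hor 59 f59 Y59 DL)) = (l.map fun i => WW (x ^ (59 ^ i)) (ev x V59)).prod *
          ev (ev x V59 ^ 2) DL := by
    intro l hl
    induction l with
    | nil => simp [ev_hor 59 hp x f59 hx, hy]
    | cons i l ih =>
      simp only [List.foldr_cons, List.map_cons, List.prod_cons]
      rw [ev_mul 59 hp x f59 hx, ih (fun j hj => hl j (List.mem_cons_of_mem _ hj)),
        ev_hor2 59 hp x f59 hx, W_sem hp x hx, Z_sem hp x hx i (hl i List.mem_cons_self)]
      ring
  rw [key _ (by decide)] at h3
  have h1' : ev x [1] = (1 : A) := by simp [ev]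
  rw [h1'] at h3
  constructor
  · intro h0
    rw [h0] at h3; simp at h3
  · intro i hi h0
    rw [List.prod_eq_zero (List.mem_map.mpr ⟨i, hi, h0⟩)] at h3; simp at h3
end sem
end M11P
namespace M11P
open Polynomial NumberField

theorem frobPkg (E : Type) [Field E] [NumberField E] [IsGalois ℚ E] (p : ℕ) (hp : p.Prime) :
    ∃ (k : Type) (_ : Field k) (_ : CharP k p) (θ : 𝓞 E →+* k) (φ : E ≃ₐ[ℚ] E),
      ∀ a b : 𝓞 E, (b : E) = φ a → θ b = θ a ^ p := by
  have : Fact p.Prime := ⟨hp⟩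
  have hPp : Prime (p : ℤ) := Nat.prime_iff_prime_int.mp hp
  have hP : (Ideal.span {(p : ℤ)}).IsMaximal :=
    PrincipalIdealRing.isMaximal_of_irreducible hPp.irreducible
  obtain ⟨Q, hQm, hQo⟩ := Ideal.exists_maximal_ideal_liesOver_of_isIntegral (S := 𝓞 E) (Ideal.span {(p : ℤ)})
  have hunder : Q.under ℤ = Ideal.span {(p : ℤ)} := hQo.over.symm
  have hpQ : (p : 𝓞 E) ∈ Q := by
    have : (p : ℤ) ∈ Q.under ℤ := by rw [hunder]; exact Ideal.mem_span_singleton_self _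
    simpa [Ideal.mem_comap] using this
  have hQ0 : Q ≠ ⊥ := by
    rintro rfl
    rw [Ideal.mem_bot] at hpQ
    exact hp.ne_zero (by exact_mod_cast hpQ)
  have hfin : Finite (𝓞 E ⧸ Q) := Ideal.finiteQuotientOfFreeOfNeBot Q hQ0
  have hinv : Algebra.IsInvariant ℤ (𝓞 E) (E ≃ₐ[ℚ] E) := by
    refine ⟨fun b hb => ?_⟩
    have h1 : (b : E) ∈ (⊥ : IntermediateField ℚ E) := by
      rw [IsGalois.mem_bot_iff_fixed]
      intro g
      exact congrArg (algebraMap (𝓞 E) E) (hb g)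
    rw [IntermediateField.mem_bot] at h1
    obtain ⟨c, hc⟩ := h1
    have h2 : IsIntegral ℤ c := by
      rw [← isIntegral_algebraMap_iff (FaithfulSMul.algebraMap_injective ℚ E), hc]
      exact RingOfIntegers.isIntegral_coe b
    obtain ⟨n, rfl⟩ := IsIntegrallyClosed.algebraMap_eq_of_integral h2
    refine ⟨n, RingOfIntegers.ext ?_⟩
    rw [← hc]; simp
  obtain ⟨φ, hφ⟩ := IsArithFrobAt.exists_of_isInvariant ℤ (E ≃ₐ[ℚ] E) Q
  refine ⟨𝓞 E ⧸ Q, Ideal.Quotient.field Q, ?_, Ideal.Quotient.mk Q, φ, ?_⟩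
  · refine (CharP.charP_iff_prime_eq_zero hp).mpr ?_
    rw [← map_natCast (Ideal.Quotient.mk Q), Ideal.Quotient.eq_zero_iff_mem]
    exact hpQ
  · intro a b hab
    have hb : b = φ • a := RingOfIntegers.ext hab
    have h3 := hφ a
    have hcard : Nat.card (ℤ ⧸ Q.under ℤ) = p := by
      rw [hunder]
      simpa using Int.card_ideal_quot p
    rw [hcard] at h3
    rw [← map_pow, Ideal.Quotient.eq, hb]
    exact h3
end M11P
namespace M11P
open Equiv

def chi (x : Fin 12) (j : Fin 11) : Bool :=
  x.val == 11 || [1, 3, 4, 5, 9].contains ((x.val + 11 - j.val) % 11)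

abbrev T := Perm (Fin 12) × Perm (Fin 11)

def MM : Subgroup T where
  carrier := {g | ∀ x x' j, (chi x j == chi x' j) = (chi (g.1 x) (g.2 j) == chi (g.1 x') (g.2 j))}
  one_mem' := fun x x' j => rfl
  mul_mem' := by
    intro a b ha hb x x' j
    rw [hb x x' j, ha (b.1 x) (b.1 x') (b.2 j)]; rfl
  inv_mem' := by
    intro a ha x x' j
    have := ha (a⁻¹.1 x) (a⁻¹.1 x') (a⁻¹.2 j)
    rw [this]; simp

theorem mem_MM (g : T) : g ∈ MM ↔ ∀ x x' j,
    (chi x j == chi x' j) = (chi (g.1 x) (g.2 j) == chi (g.1 x') (g.2 j)) := Iff.rfl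

def rel (k : Fin 11) (y x w : Fin 12) : Prop :=
  (∀ j ∈ ([0,1,2,3] : List (Fin 11)), (chi 0 j == chi x j) = (chi y j == chi w j)) ∧
    (chi 0 4 == chi x 4) = (chi y k == chi w k)

instance (k y x w) : Decidable (rel k y x w) := by unfold rel; infer_instance

theorem chi_rig1 : ∀ k : Fin 11, k ∉ ([0,1,2,3] : List (Fin 11)) → ∀ y : Fin 12,
   (∀ x : Fin 12, ∃ w : Fin 12, rel k y x w) → ∀ x w, rel k y x w → w = x := by
  decide +kernel

theorem chi_rig2 : ∀ j j' : Fin 11, (∀ x x', (chi x j == chi x' j) = (chi x j' == chi x' j')) →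
    j = j' := by decide +kernel

theorem MM_fst {g : T} (hg : g ∈ MM) (h : g.1 = 1) : g = 1 := by
  refine Prod.ext h (Equiv.ext fun j => ?_)
  refine (chi_rig2 j (g.2 j) fun x x' => ?_).symm
  have := hg x x' j
  rw [h] at this; exact this

theorem MM_rig {g : T} (hg : g ∈ MM) (h : ∀ j ∈ ([0,1,2,3] : List (Fin 11)), g.2 j = j) :
    g = 1 := by
  have key : ∀ x, rel (g.2 4) (g.1 0) x (g.1 x) := by
    intro x
    refine ⟨fun j hj => ?_, hg 0 x 4⟩
    have := hg 0 x j
    rwa [h j hj] at this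
  have h4 : g.2 4 ∉ ([0,1,2,3] : List (Fin 11)) := by
    intro hm
    have := g.2.injective (h _ hm)
    rw [this] at hm
    revert hm; decide
  exact MM_fst hg (Equiv.ext fun x => chi_rig1 _ h4 _ (fun x => ⟨_, key x⟩) x _ (key x))

theorem card_MM_le : Nat.card MM ≤ 7920 := by
  let e : Fin 4 ↪ Fin 11 := Fin.castLEEmb (by norm_num)
  let f : MM → (Fin 4 ↪ Fin 11) := fun g => e.trans g.1.2.toEmbedding
  have hf : Function.Injective f := by
    intro a b hab
    have h1 : ∀ i, a.1.2 (e i) = b.1.2 (e i) := fun i => DFunLike.congr_fun hab i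
    have : (b⁻¹ * a : MM).1 = 1 := by
      apply MM_rig (b⁻¹ * a).2
      have h2 : ∀ i, (b⁻¹ * a : MM).1.2 (e i) = e i := by
        intro i
        show b.1.2⁻¹ (a.1.2 (e i)) = e i
        rw [h1]; simp
      intro j hj
      fin_cases hj
      · exact h2 0
      · exact h2 1
      · exact h2 2
      · exact h2 3
    have h3 : b⁻¹ * a = 1 := Subtype.ext this
    exact (inv_mul_eq_one.mp h3).symm
  calc Nat.card MM ≤ Nat.card (Fin 4 ↪ Fin 11) := Nat.card_le_card_of_injective f hf
    _ = 7920 := by rw [Nat.card_eq_fintype_card, Fintype.card_embedding_eq]; decide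

def sP : T := (⟨![1,2,3,4,5,6,7,8,9,10,0,11], ![10,0,1,2,3,4,5,6,7,8,9,11], by decide, by decide⟩,
  ⟨![1,2,3,4,5,6,7,8,9,10,0], ![10,0,1,2,3,4,5,6,7,8,9], by decide, by decide⟩)

def gP : T := (⟨![6, 1, 8, 9, 5, 3, 7, 2, 0, 11, 10, 4], ![8,1,7,5,11,4,0,6,2,3,10,9], by decide, by decide⟩,
  ⟨![0, 8, 7, 5, 10, 6, 1, 4, 3, 2, 9], ![0,6,9,8,7,3,5,2,1,10,4], by decide, by decide⟩)

def tP : T := gP * sP * gP⁻¹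

theorem sP_mem : sP ∈ MM := by rw [mem_MM]; decide +kernel
theorem gP_mem : gP ∈ MM := by rw [mem_MM]; decide +kernel
theorem sP_ord : orderOf sP = 11 := by
  have : Fact (Nat.Prime 11) := ⟨by norm_num⟩
  exact orderOf_eq_prime (by decide +kernel) (by decide +kernel)

/-- doubling lemma -/
theorem ext_card {G : Type*} [Group G] [Finite G] (K : Subgroup G) (q : ℕ) [Fact q.Prime] (a b : G)
    (ha : a ∈ K) (hb : b ∈ K) (h1 : b * a * b⁻¹ ∈ Subgroup.zpowers a) (h2 : b ^ q ∈ Subgroup.zpowers a)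
    (h3 : b ∉ Subgroup.zpowers a) : orderOf a * q ∣ Nat.card K := by
  let A := Subgroup.zpowers a
  let N := Subgroup.normalizer (A : Set G)
  have hbN : b ∈ N := by
    have hle : A.map (MulAut.conj b).toMonoidHom ≤ A := by
      rw [MonoidHom.map_zpowers, Subgroup.zpowers_le]
      simpa using h1
    have heq : A.map (MulAut.conj b).toMonoidHom = A := by
      apply Subgroup.eq_of_le_of_card_ge hle
      rw [Subgroup.card_map_of_injective (MulAut.conj b).injective]
    rw [Subgroup.mem_normalizer_iff]
    intro h
    constructor
    · intro hh
      exact hle ⟨h, hh, by simp⟩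
    · intro hh
      have : b * h * b⁻¹ ∈ A.map (MulAut.conj b).toMonoidHom := by rw [heq]; exact hh
      obtain ⟨h', hh', e⟩ := this
      have e' : b * h' * b⁻¹ = b * h * b⁻¹ := by simpa using e
      have : h' = h := by simpa using e'
      rw [← this]; exact hh'
  let N' := N ⊓ K
  have hAN : A ≤ N' := le_inf Subgroup.le_normalizer (by
    rw [Subgroup.zpowers_le]; exact ha)
  have hn : (A.subgroupOf N').Normal := by
    have : (A.subgroupOf N).Normal := Subgroup.normal_in_normalizer
    constructor
    intro x hx y
    have := this.conj_mem ⟨x.1, x.2.1⟩ hx ⟨y.1, y.2.1⟩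
    exact this
  let bq : N' ⧸ A.subgroupOf N' := QuotientGroup.mk ⟨b, hbN, hb⟩
  have ob : orderOf bq = q := by
    apply orderOf_eq_prime
    · rw [← QuotientGroup.mk_pow, QuotientGroup.eq_one_iff]
      exact h2
    · intro h
      rw [QuotientGroup.eq_one_iff] at h
      exact h3 h
  have hq : q ∣ Nat.card (N' ⧸ A.subgroupOf N') := ob ▸ orderOf_dvd_natCard bq
  have hc : Nat.card N' = Nat.card (N' ⧸ A.subgroupOf N') * Nat.card (A.subgroupOf N') :=
    Subgroup.card_eq_card_quotient_mul_card_subgroup _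
  have hc2 : Nat.card (A.subgroupOf N') = orderOf a := by
    rw [Nat.card_congr (Subgroup.subgroupOfEquivOfLe hAN).toEquiv, Nat.card_zpowers]
  have : orderOf a * q ∣ Nat.card N' := by
    rw [hc, hc2, mul_comm]; exact Nat.mul_dvd_mul_right hq _
  exact this.trans (Subgroup.card_dvd_of_le inf_le_right)

def aP : T := sP * tP * tP * sP * tP * sP
def bP : T := sP * tP
def cP : T := sP * sP * tP * sP * sP
def dP : T := tP * tP * sP * tP * sP * tP * tP * tP
def eP : T := tP * sP * sP

theorem aP_ord : orderOf aP = 8 :=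
  orderOf_eq_prime_pow (p := 2) (n := 2) (by decide +kernel) (by decide +kernel)
theorem cP_ord : orderOf cP = 3 := by
  have : Fact (Nat.Prime 3) := ⟨by norm_num⟩
  exact orderOf_eq_prime (by decide +kernel) (by decide +kernel)
theorem eP_ord : orderOf eP = 5 := by
  have : Fact (Nat.Prime 5) := ⟨by norm_num⟩
  exact orderOf_eq_prime (by decide +kernel) (by decide +kernel)

theorem not_zp {a b : T} (n : ℕ) (hn : orderOf a = n) (h : ∀ i < n, b ≠ a ^ i) :
    b ∉ Subgroup.zpowers a := by
  classical
  intro hb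
  rw [mem_zpowers_iff_mem_range_orderOf, hn] at hb
  simp only [Finset.mem_image, Finset.mem_range] at hb
  obtain ⟨i, hi, e⟩ := hb
  exact h i hi e.symm

theorem big {K : Subgroup T} (hs : sP ∈ K) (ht : tP ∈ K) : 7920 ∣ Nat.card K := by
  have m {x y} (hx : x ∈ K) (hy : y ∈ K) : x * y ∈ K := K.mul_mem hx hy
  have hb : bP ∈ K := m hs ht
  have he : eP ∈ K := m (m ht hs) hs
  have hc : cP ∈ K := m (m (m (m hs hs) ht) hs) hs
  have ha : aP ∈ K := m (m (m (m (m hs ht) ht) hs) ht) hs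
  have hd : dP ∈ K := m (m (m (m (m (m (m ht ht) hs) ht) hs) ht) ht) ht
  have : Fact (Nat.Prime 3) := ⟨by norm_num⟩
  have h16 := ext_card K 2 aP bP ha hb ⟨3, by decide +kernel⟩ ⟨4, by decide +kernel⟩
    (not_zp 8 aP_ord (by decide +kernel))
  have h9 := ext_card K 3 cP dP hc hd ⟨1, by decide +kernel⟩ ⟨0, by decide +kernel⟩
    (not_zp 3 cP_ord (by decide +kernel))
  have h5 : 5 ∣ Nat.card K := by
    have := Subgroup.orderOf_dvd_natCard K he
    rwa [eP_ord] at this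
  have h11 : 11 ∣ Nat.card K := by
    have := Subgroup.orderOf_dvd_natCard K hs
    rwa [sP_ord] at this
  rw [aP_ord] at h16
  rw [cP_ord] at h9
  omega

theorem tP_mem : tP ∈ MM := MM.mul_mem (MM.mul_mem gP_mem sP_mem) (MM.inv_mem gP_mem)

theorem card_MM : Nat.card MM = 7920 :=
  le_antisymm card_MM_le (Nat.le_of_dvd Nat.card_pos (big sP_mem tP_mem))



noncomputable def act11 : MM →* Perm (Fin 11) := (MonoidHom.snd _ _).comp MM.subtype

theorem sP_pow_trans : ∀ i j : Fin 11, ∃ n ∈ List.range 11, (sP ^ n).2 i = j := by decide +kernel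

theorem MM_simple_aux (N : Subgroup MM) [N.Normal] (hN : N ≠ ⊥) : N = ⊤ := by
  classical
  let _ : MulAction MM (Fin 11) := MulAction.compHom (Fin 11) act11
  have hsm : ∀ (g : MM) (i : Fin 11), g • i = g.1.2 i := fun g i => rfl
  have : MulAction.IsPretransitive MM (Fin 11) := ⟨by
    intro i j
    obtain ⟨n, -, hn⟩ := sP_pow_trans i j
    exact ⟨⟨sP, sP_mem⟩ ^ n, hn⟩⟩
  have : MulAction.IsPreprimitive MM (Fin 11) :=
    MulAction.IsPreprimitive.of_prime_card (by rw [Nat.card_eq_fintype_card, Fintype.card_fin]; norm_num)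
  have hfix : MulAction.fixedPoints N (Fin 11) ≠ Set.univ := by
    intro h
    apply hN
    rw [eq_bot_iff]
    intro g hg
    have : ∀ i, g.1.2 i = i := by
      intro i
      have : i ∈ MulAction.fixedPoints N (Fin 11) := by rw [h]; trivial
      exact this ⟨g, hg⟩
    rw [Subgroup.mem_bot]
    exact Subtype.ext (MM_rig g.2 fun j _ => this j)
  have := MulAction.IsQuasiPreprimitive.isPretransitive_of_normal hfix
  have : Fact (Nat.Prime 11) := ⟨by norm_num⟩
  have h11 : 11 ∣ Nat.card N := by
    have h1 := MulAction.index_stabilizer_of_transitive (G := N) (0 : Fin 11)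
    rw [Nat.card_eq_fintype_card, Fintype.card_fin] at h1
    have h2 := Subgroup.index_dvd_card (MulAction.stabilizer N (0 : Fin 11))
    rwa [h1] at h2
  obtain ⟨n, hn⟩ := exists_prime_orderOf_dvd_card' 11 h11
  let s : MM := ⟨sP, sP_mem⟩
  have hs : orderOf s = 11 := (Subgroup.orderOf_mk sP sP_mem).trans sP_ord
  have hn' : orderOf (n : MM) = 11 := by rw [Subgroup.orderOf_coe, hn]
  have hfac : (7920 : ℕ).factorization 11 = 1 := by
    rw [show 7920 = 11 * 720 by norm_num, Nat.factorization_mul (by norm_num) (by norm_num),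
      Finsupp.add_apply, Nat.Prime.factorization_self (by norm_num),
      Nat.factorization_eq_zero_of_not_dvd (by norm_num)]
  let P : Sylow 11 MM := Sylow.ofCard (Subgroup.zpowers s) (by
    rw [Nat.card_zpowers, hs, card_MM, hfac, pow_one])
  let Q : Sylow 11 MM := Sylow.ofCard (Subgroup.zpowers (n : MM)) (by
    rw [Nat.card_zpowers, hn', card_MM, hfac, pow_one])
  obtain ⟨g, hg⟩ := MulAction.exists_smul_eq MM Q P
  have hPN : (P : Subgroup MM) ≤ N := by
    rw [← hg]
    have hQ : (Q : Subgroup MM) ≤ N := by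
      show Subgroup.zpowers (n : MM) ≤ N
      rw [Subgroup.zpowers_le]; exact n.2
    rw [Sylow.coe_subgroup_smul]
    rintro x ⟨y, hy, rfl⟩
    exact ‹N.Normal›.conj_mem y (hQ hy) g
  have hsN : s ∈ N := hPN (Subgroup.mem_zpowers s)
  have htN : (⟨gP, gP_mem⟩ * s * (⟨gP, gP_mem⟩)⁻¹ : MM) ∈ N := ‹N.Normal›.conj_mem s hsN _
  have hb := big (K := N.map MM.subtype) ⟨s, hsN, rfl⟩ ⟨_, htN, rfl⟩
  rw [Subgroup.card_map_of_injective MM.subtype_injective] at hb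
  apply Subgroup.eq_top_of_card_eq
  rw [card_MM]
  refine le_antisymm ?_ (Nat.le_of_dvd Nat.card_pos hb)
  rw [← card_MM]
  exact Subgroup.card_le_card_group N

theorem MM_simple : IsSimpleGroup MM := by
  have : Nontrivial MM := by
    rw [← Finite.one_lt_card_iff_nontrivial, card_MM]; norm_num
  exact ⟨fun N hN => or_iff_not_imp_left.mpr fun h => @MM_simple_aux N hN h⟩

theorem MM_top (H : Subgroup MM) (h : 1320 ∣ Nat.card H) : H = ⊤ := by
  classical
  have := MM_simple
  by_contra hne
  have hi : H.index ≤ 6 := by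
    have h1 := H.card_mul_index
    rw [card_MM] at h1
    obtain ⟨c, hc⟩ := h
    have hc0 : 0 < c := by
      rcases Nat.eq_zero_or_pos c with h0 | h0
      · rw [h0] at hc; have := Nat.card_pos (α := H); omega
      · exact h0
    rw [hc] at h1
    nlinarith
  rcases IsSimpleGroup.eq_bot_or_eq_top_of_normal H.normalCore inferInstance with h0 | h0
  · have hker : (MulAction.toPermHom MM (MM ⧸ H)).ker = ⊥ := by
      rw [← Subgroup.normalCore_eq_ker, h0]
    have hinj := (MonoidHom.ker_eq_bot_iff _).mp hker
    have hc := Nat.card_le_card_of_injective _ hinj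
    rw [Nat.card_perm, card_MM] at hc
    have : (Nat.card (MM ⧸ H)).factorial ≤ Nat.factorial 6 := Nat.factorial_le hi
    have h6 : Nat.factorial 6 = 720 := by decide
    omega
  · apply hne
    rw [eq_top_iff, ← h0]
    exact Subgroup.normalCore_le H

end M11P
namespace M11P
open Polynomial NumberField

set_option linter.unusedSectionVars false
section poly
variable {R : Type*} [CommRing R] [IsDomain R]

theorem evX_degree (l : List ℤ) : (ev (X : R[X]) l).degree < l.length := by
  induction l with
  | nil => simp [ev]
  | cons c l ih =>
    simp only [ev, List.length_cons]
    refine lt_of_le_of_lt (degree_add_le _ _) (max_lt ?_ ?_)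
    · have : (c : R[X]) = C (c : R) := by simp
      rw [this]
      refine lt_of_le_of_lt degree_C_le ?_
      exact_mod_cast Nat.succ_pos _
    · rw [mul_comm, degree_mul_X]
      push_cast
      exact WithBot.add_lt_add_right (by simp) ih

theorem emX_monic (l : List ℤ) : (em (X : R[X]) l).Monic :=
  monic_X_pow_add (evX_degree l)

theorem emX_natDegree (l : List ℤ) : (em (X : R[X]) l).natDegree = l.length := by
  apply natDegree_eq_of_degree_eq_some
  rw [em, degree_add_eq_left_of_degree_lt] <;> rw [degree_X_pow]
  exact evX_degree l

theorem emX_eval (x : R) (l : List ℤ) : (em (X : R[X]) l).eval x = em x l := by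
  have := map_em (evalRingHom x) X l
  simpa using this

theorem ev2X_natDegree (y : R) (l : List (List ℤ)) :
    (ev2 (X : R[X]) (C y) l).natDegree ≤ l.length - 1 := by
  induction l with
  | nil => simp [ev2]
  | cons c l ih =>
    simp only [ev2, ← map_ev C, List.length_cons]
    cases l with
    | nil => simp [ev2]
    | cons d m =>
      refine natDegree_add_le_of_degree_le (by simp) ?_
      refine natDegree_mul_le.trans ?_
      simp only [List.length_cons] at ih
      simp only [natDegree_X, List.length_cons]
      lia

theorem ev2X_eval (x y : R) (l : List (List ℤ)) :
    (ev2 (X : R[X]) (C y) l).eval x = ev2 x y l := by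
  have := map_ev2 (evalRingHom x) X (C y) l
  simpa using this

noncomputable def WP (v : R) : R[X] := ev2 X (C (v ^ 2)) GLs + C v * ev2 X (C (v ^ 2)) HLs

theorem WP_eval (x v : R) : (WP v).eval x = WW x v := by
  simp only [WP, WW, eval_add, eval_mul, eval_C, ev2X_eval]

theorem WP_natDegree (v : R) : (WP v).natDegree ≤ 6 := by
  refine natDegree_add_le_of_degree_le (ev2X_natDegree _ _) ?_
  refine natDegree_mul_le.trans ?_
  have := ev2X_natDegree (v ^ 2) HLs
  simp only [natDegree_C, HLs, List.length] at this ⊢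
  lia

theorem roots_bound (P : R[X]) (hP : P ≠ 0) (S : Finset R) (h : ∀ a ∈ S, P.eval a = 0) :
    S.card ≤ P.natDegree :=
  card_le_degree_of_subset_roots (fun a ha => (mem_roots hP).mpr (h a ha))

theorem em_all {n : ℕ} (l : List ℤ) (hn : l.length = n) {ι : Type} [Fintype ι] (hι : Fintype.card ι = n)
    (z : ι → R) (hz : Function.Injective z)
    (h : ∀ i, em (z i) l = 0) (w : R) (hw : em w l = 0) : ∃ i, z i = w := by
  classical
  by_contra! hne
  have h1 := roots_bound (em (X : R[X]) l) (emX_monic l).ne_zero (insert w (Finset.univ.image z))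
    (by
      intro a ha
      rw [emX_eval]
      rcases Finset.mem_insert.mp ha with rfl | ha
      · exact hw
      · obtain ⟨i, -, rfl⟩ := Finset.mem_image.mp ha
        exact h i)
  rw [emX_natDegree, Finset.card_insert_of_notMem (by simpa using hne),
    Finset.card_image_of_injective _ hz, Finset.card_univ] at h1
  lia
end poly

section lift
variable {E : Type} [Field E] [NumberField E]

theorem em_lift (r : List ℤ) (hs : (em (X : E[X]) r).Splits) :
    ∃ s : Multiset (𝓞 E), (em (X : (𝓞 E)[X]) r) = (s.map fun a => X - C a).prod := by
  have h1 := hs.eq_prod_roots_of_monic (emX_monic r)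
  have h2 : ∀ a ∈ (em (X : E[X]) r).roots, IsIntegral ℤ a := by
    intro a ha
    have h3 := isRoot_of_mem_roots ha
    rw [IsRoot, emX_eval] at h3
    refine ⟨em X r, emX_monic r, ?_⟩
    have := map_em (eval₂RingHom (algebraMap ℤ E) a) X r
    simp only [coe_eval₂RingHom, eval₂_X] at this
    rw [this, h3]
  obtain ⟨s, hs'⟩ : ∃ s : Multiset (𝓞 E), s.map (algebraMap (𝓞 E) E) = (em (X : E[X]) r).roots := by
    clear h1
    generalize (em (X : E[X]) r).roots = m at h2
    induction m using Multiset.induction_on with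
    | empty => exact ⟨0, rfl⟩
    | cons a m ih =>
      obtain ⟨s, hs⟩ := ih fun b hb => h2 b (Multiset.mem_cons_of_mem hb)
      obtain ⟨b, hb⟩ := (IsIntegralClosure.isIntegral_iff (A := 𝓞 E) (R := ℤ) (x := a)).mp
        (h2 a (Multiset.mem_cons_self _ _))
      refine ⟨b ::ₘ s, ?_⟩
      rw [Multiset.map_cons, hs, ← hb]
  refine ⟨s, ?_⟩
  apply Polynomial.map_injective (algebraMap (𝓞 E) E) (FaithfulSMul.algebraMap_injective _ _)
  have h4 : (em (X : (𝓞 E)[X]) r).map (algebraMap (𝓞 E) E) = em X r := by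
    have := map_em (mapRingHom (algebraMap (𝓞 E) E)) X r
    simpa using this
  rw [h4, h1, ← hs', Polynomial.map_multiset_prod]
  simp [Multiset.map_map]

theorem em_lift_root {k : Type} [Field k] (θ : 𝓞 E →+* k) (r : List ℤ)
    (hs : (em (X : E[X]) r).Splits) (α : k) (hα : em α r = 0) :
    ∃ z : 𝓞 E, em z r = 0 ∧ θ z = α := by
  obtain ⟨s, h⟩ := em_lift r hs
  have h1 : em α r = (s.map fun a => α - θ a).prod := by
    have := map_em (eval₂RingHom θ α) X r
    rw [h, map_multiset_prod] at this
    simpa [Multiset.map_map] using this.symm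
  rw [hα] at h1
  obtain ⟨a, ha, h2⟩ := Multiset.mem_map.mp (Multiset.prod_eq_zero_iff.mp h1.symm)
  refine ⟨a, ?_, (sub_eq_zero.mp h2).symm⟩
  rw [← emX_eval, h, eval_multiset_prod, Multiset.prod_eq_zero_iff]
  exact Multiset.mem_map.mpr ⟨X - C a, Multiset.mem_map.mpr ⟨a, ha, rfl⟩, by simp⟩

theorem em_red_splits {k : Type} [Field k] (θ : 𝓞 E →+* k) (r : List ℤ)
    (hs : (em (X : E[X]) r).Splits) : (em (X : k[X]) r).Splits := by
  obtain ⟨s, h⟩ := em_lift r hs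
  have h1 : em (X : k[X]) r = (s.map fun a => X - C (θ a)).prod := by
    have := map_em (mapRingHom θ) X r
    rw [h, map_multiset_prod] at this
    simpa [Multiset.map_map] using this.symm
  rw [h1]
  refine Splits.multisetProd ?_
  intro f hf
  obtain ⟨a, -, rfl⟩ := Multiset.mem_map.mp hf
  exact Splits.X_sub_C _

theorem red_root {k : Type} [Field k] (p : ℕ) [CharP k p] (θ : 𝓞 E →+* k)
    (hs : (em (X : E[X]) FL).Splits) (f g : List ℤ) (hf : f ≠ []) (h : okF p f g = true) :
    ∃ α : k, em α f = 0 ∧ ∃ z : 𝓞 E, em z FL = 0 ∧ θ z = α := by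
  have hp : ((p : ℤ) : k) = 0 := by simp
  have hp' : ((p : ℤ) : k[X]) = 0 := by
    have : ((p : ℤ) : k[X]) = C ((p : ℤ) : k) := by simp
    rw [this, hp, C_0]
  have h1 := okF_sem (A := k[X]) p hp' f g h X
  have h2 : (em (X : k[X]) f).Splits :=
    (em_red_splits θ FL hs).of_dvd (emX_monic FL).ne_zero ⟨_, h1⟩
  obtain ⟨α, hα⟩ := h2.exists_eval_eq_zero (by
    rw [degree_eq_natDegree (emX_monic f).ne_zero, emX_natDegree]
    have : f.length ≠ 0 := by simpa using hf
    exact_mod_cast this)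
  rw [emX_eval] at hα
  refine ⟨α, hα, em_lift_root θ FL hs α ?_⟩
  rw [okF_sem p hp f g h, hα, zero_mul]

theorem smul_em (τ : E ≃ₐ[ℚ] E) (z : 𝓞 E) (r : List ℤ) : em (τ • z) r = τ • em z r :=
  (map_em (MulSemiringAction.toRingHom _ (𝓞 E) τ) z r).symm

theorem smul_ev (τ : E ≃ₐ[ℚ] E) (z : 𝓞 E) (r : List ℤ) : ev (τ • z) r = τ • ev z r :=
  (map_ev (MulSemiringAction.toRingHom _ (𝓞 E) τ) z r).symm

theorem smul_WW (τ : E ≃ₐ[ℚ] E) (z v : 𝓞 E) : WW (τ • z) (τ • v) = τ • WW z v := by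
  have h := fun l => map_ev2 (MulSemiringAction.toRingHom _ (𝓞 E) τ) z (v ^ 2) l
  simp only [MulSemiringAction.toRingHom_apply] at h
  simp only [WW, smul_add, smul_mul', h, smul_pow']

theorem map_WW {B : Type*} [CommRing B] (θ : 𝓞 E →+* B) (z v : 𝓞 E) : WW (θ z) (θ v) = θ (WW z v) := by
  simp [WW, map_ev2]

theorem frob2 [IsGalois ℚ E] (p : ℕ) (hp : p.Prime) :
    ∃ (k : Type) (_ : Field k) (_ : CharP k p) (θ : 𝓞 E →+* k) (φ : E ≃ₐ[ℚ] E),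
      ∀ (n : ℕ) (a : 𝓞 E), θ (φ ^ n • a) = θ a ^ (p ^ n) := by
  obtain ⟨k, i1, i2, θ, φ, h⟩ := frobPkg E p hp
  refine ⟨k, i1, i2, θ, φ, fun n => ?_⟩
  induction n with
  | zero => simp
  | succ n ih =>
    intro a
    rw [pow_succ', mul_smul, h (φ ^ n • a) _ rfl, ih, ← pow_mul, pow_succ]

theorem period_cert [IsGalois ℚ E] (hs : (em (X : E[X]) FL).Splits) (p : ℕ) (hp : p.Prime) (q e : ℕ)
    (hq : q.Prime) (f g i : List ℤ) (hf : f ≠ []) (hfg : okF p f g = true) (bs : List Bool)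
    (hbs : bval bs = p) (h : okPer p f i bs (q ^ (e + 1)) (q ^ e) = true) :
    ∃ (φ : E ≃ₐ[ℚ] E) (z : 𝓞 E), em z FL = 0 ∧ ∀ n, φ ^ n • z = z → q ^ (e + 1) ∣ n := by
  obtain ⟨k, _, _, θ, φ, hφ⟩ := frob2 (E := E) p hp
  obtain ⟨α, hα, z, hz, hzα⟩ := red_root p θ hs f g hf hfg
  refine ⟨φ, z, hz, fun n hn => ?_⟩
  have h0 : ((p : ℤ) : k) = 0 := by simp
  obtain ⟨h1, h2⟩ := okPer_sem p h0 f i bs _ _ h α hα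
  rw [hbs] at h1 h2
  have : Fact q.Prime := ⟨hq⟩
  have hm : Function.minimalPeriod (fun x : k => x ^ p) α = q ^ (e + 1) := by
    apply Function.minimalPeriod_eq_prime_pow
    · rw [Function.IsPeriodicPt, Function.IsFixedPt, pow_iterate]; exact h2
    · rw [Function.IsPeriodicPt, Function.IsFixedPt, pow_iterate]; exact h1
  rw [← hm]
  apply Function.IsPeriodicPt.minimalPeriod_dvd
  rw [Function.IsPeriodicPt, Function.IsFixedPt, pow_iterate]
  change α ^ p ^ n = α
  rw [← hzα, ← hφ, hn]
end lift
end M11P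
namespace M11P
open Polynomial NumberField

def sh (j : ℕ) (x : Fin 12) : Fin 12 :=
  if x.val = 11 then x else ⟨(x.val + j) % 11, by lia⟩

theorem chi_sh : ∀ (x : Fin 12) (j : Fin 11), chi (sh (11 - j.val) x) 0 = chi x j ∧
    sh j.val (sh (11 - j.val) x) = x := by decide +kernel

theorem chi_pat : ∀ (q q' : Fin 11 × Bool), (∀ x, chi x q.1 = q.2 ↔ chi x q'.1 = q'.2) → q = q' := by
  decide +kernel

theorem chi_zero : ∀ x : Fin 12, chi x 0 = false ↔ x.val ∈ ([0, 2, 6, 7, 8, 10] : List ℕ) := by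
  decide +kernel

theorem chi_zero_card : (Finset.univ.filter fun x : Fin 12 => chi x 0 = false).card = 6 := by
  decide +kernel

theorem bool_aux : ∀ a b c d e : Bool, (a = true ↔ c = e) → (b = true ↔ d = e) →
    (a == b) = (c == d) := by decide

section lab
variable {E : Type} [Field E] [NumberField E] [IsGalois ℚ E]

/-- the roots of the degree 12 polynomial, labelled by a Frobenius at 59 -/
theorem label_roots (hs : (em (X : E[X]) FL).Splits) (k : Type) [Field k] [CharP k 59]
    (θ : 𝓞 E →+* k) (φ : E ≃ₐ[ℚ] E) (hφ : ∀ (n : ℕ) (a : 𝓞 E), θ (φ ^ n • a) = θ a ^ (59 ^ n)) :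
    ∃ (α : k) (z : Fin 12 → 𝓞 E), em α f59 = 0 ∧ Function.Injective z ∧ (∀ i, em (z i) FL = 0) ∧
      (∀ i : Fin 12, i.val < 11 → θ (z i) = α ^ (59 ^ i.val)) ∧
      (∀ (j : ℕ) x, φ ^ j • z x = z (sh j x)) := by
  have h59 : ((59 : ℤ) : k) = 0 := by
    have := CharP.cast_eq_zero k 59
    exact_mod_cast this
  obtain ⟨α, hα, z0, hz0, hz0α⟩ := red_root 59 θ hs f59 g59 (by decide) oF59
  have h19 : em (19 : k) FL = 0 := by
    rw [okF_sem 59 h59 f59 g59 oF59]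
    have : ev (19 : k) g59 = 0 := by
      simp only [ev, g59]
      push_cast
      push_cast at h59
      linear_combination h59
    rw [this, mul_zero]
  obtain ⟨w, hw, hw19⟩ := em_lift_root θ FL hs 19 h19
  have : Fact (Nat.Prime 11) := ⟨by norm_num⟩
  have hfix : ∀ n : ℕ, (19 : k) ^ (59 ^ n) = 19 := by
    intro n
    have : Fact (Nat.Prime 59) := ⟨by norm_num⟩
    have h := map_natCast (iterateFrobenius k 59 n) 19
    rw [iterateFrobenius_def] at h
    exact_mod_cast h
  have hm : Function.minimalPeriod (fun x : k => x ^ 59) α = 11 := by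
    refine Function.minimalPeriod_eq_prime ?_ ?_
    · rw [Function.IsPeriodicPt, Function.IsFixedPt, pow_iterate]; exact Z_sem' h59 α hα
    · exact Z_ne h59 α hα
  have hmod : ∀ n : ℕ, α ^ (59 ^ (n % 11)) = α ^ (59 ^ n) := by
    intro n
    have h := Function.iterate_mod_minimalPeriod_eq (f := fun x : k => x ^ 59) (x := α) (n := n)
    rw [hm, pow_iterate, pow_iterate] at h
    exact h
  have hinj : ∀ i j : ℕ, i < 11 → j < 11 → α ^ (59 ^ i) = α ^ (59 ^ j) → i = j := by
    intro i j hi hj hij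
    have h := Function.iterate_injOn_Iio_minimalPeriod (f := fun x : k => x ^ 59) (x := α)
    rw [hm] at h
    refine h hi hj ?_
    simp only [pow_iterate]
    exact hij
  have hne : ∀ i : ℕ, i < 11 → α ^ (59 ^ i) ≠ 19 := by
    intro i hi h
    apply Z_ne h59 α hα
    have h1 : α = 19 := by
      rw [← Z_sem' h59 α hα, show 11 = i + (11 - i) by lia, pow_add, pow_mul, h, hfix]
    rw [h1]; simpa using hfix 1
  let z : Fin 12 → 𝓞 E := fun i => if i.val = 11 then w else φ ^ i.val • z0
  have hz1 : ∀ i : Fin 12, i.val < 11 → θ (z i) = α ^ (59 ^ i.val) := by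
    intro i hi
    simp only [z, if_neg hi.ne, hφ, hz0α]
  have hz2 : ∀ i : Fin 12, i.val = 11 → θ (z i) = 19 := by
    intro i hi
    simp only [z, if_pos hi, hw19]
  have hθ : Function.Injective fun i => θ (z i) := by
    intro i j hij
    simp only at hij
    by_cases hi : i.val = 11 <;> by_cases hj : j.val = 11
    · exact Fin.ext (hi.trans hj.symm)
    · rw [hz2 i hi, hz1 j (by lia)] at hij
      exact absurd hij.symm (hne _ (by lia))
    · rw [hz2 j hj, hz1 i (by lia)] at hij
      exact absurd hij (hne _ (by lia))
    · rw [hz1 j (by lia), hz1 i (by lia)] at hij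
      exact Fin.ext (hinj _ _ (by lia) (by lia) hij)
  have hzi : Function.Injective z := fun i j h => hθ (congrArg θ h)
  have hzr : ∀ i, em (z i) FL = 0 := by
    intro i
    simp only [z]
    split
    · exact hw
    · rw [smul_em, hz0, smul_zero]
  refine ⟨α, z, hα, hzi, hzr, hz1, fun j x => ?_⟩
  have hr : em (φ ^ j • z x) FL = 0 := by rw [smul_em, hzr, smul_zero]
  obtain ⟨y, hy⟩ := em_all FL rfl (by simp [FL]) z hzi hzr _ hr
  rw [← hy]
  congr 1
  apply hθ
  simp only
  rw [hy, hφ]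
  by_cases hx : x.val = 11
  · rw [sh, if_pos hx, hz2 x hx, hfix]
  · rw [sh, if_neg hx, hz1 x (by lia), hz1 _ (Nat.mod_lt _ (by norm_num)), ← pow_mul, ← pow_add]
    exact (hmod _).symm

theorem labelling (hs : (em (X : E[X]) FL).Splits) (hR : (em (X : E[X]) RL22).Splits) :
    ∃ (z : Fin 12 → 𝓞 E), Function.Injective z ∧ (∀ i, em (z i) FL = 0) ∧
      (∀ j : Fin 12, j.val < 11 → ∃ τ : E ≃ₐ[ℚ] E, τ • z 0 = z j) ∧
      ∀ (τ : E ≃ₐ[ℚ] E) (π : Equiv.Perm (Fin 12)), (∀ i, τ • z i = z (π i)) →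
        ∃ ρ : Equiv.Perm (Fin 11), (π, ρ) ∈ MM := by
  obtain ⟨k, _, _, θ, φ, hφ⟩ := frob2 (E := E) 59 (by norm_num)
  have h59 : ((59 : ℤ) : k) = 0 := by
    have := CharP.cast_eq_zero k 59
    exact_mod_cast this
  obtain ⟨α, z, hα, hzi, hzr, hzθ, hzs⟩ := label_roots hs k θ φ hφ
  obtain ⟨v, hv, hvα⟩ := em_lift_root θ RL22 hR _ (V_sem h59 α hα)
  have hv2 : em (v ^ 2) RL = 0 := by rw [← RL22_eq]; exact hv
  have hvn : em (-v) RL22 = 0 := by rw [RL22_eq, neg_sq]; exact hv2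
  obtain ⟨hD, hW⟩ := WD_sem h59 α hα
  have hD' : ev (v ^ 2) DL ≠ 0 := by
    intro h
    apply hD
    rw [← hvα, ← map_pow, ← map_ev, h, map_zero]
  have hprod : ∀ x, WW (z x) v = 0 ∨ WW (z x) (-v) = 0 := by
    intro x
    rw [← mul_eq_zero, WW_ident _ _ hv2, hzr, mul_zero]
  have hN : ∀ x, chi x 0 = false → WW (z x) v ≠ 0 := by
    intro x hx h
    have hx' := (chi_zero x).mp hx
    apply hW x.val hx'
    have hlt : x.val < 11 := by
      simp only [List.mem_cons, List.not_mem_nil, or_false] at hx'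
      lia
    rw [← hzθ x hlt, ← hvα, map_WW, h, map_zero]
  have hWP : WP (-v) ≠ 0 := by
    intro h
    have hC : em ((C v : (𝓞 E)[X]) ^ 2) RL = 0 := by
      rw [← C_pow, ← map_em C, hv2, C_0]
    have h1 := WW_ident (X : (𝓞 E)[X]) (C v) hC
    have h2 : WW (X : (𝓞 E)[X]) (-(C v)) = WP (-v) := by
      rw [WW, WP]; simp
    rw [h2, h, mul_zero] at h1
    have h3 : (4 : (𝓞 E)[X]) * ev ((C v : (𝓞 E)[X]) ^ 2) DL ^ 2 * em X FL ≠ 0 := by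
      refine mul_ne_zero (mul_ne_zero (by norm_num) (pow_ne_zero _ ?_)) (emX_monic FL).ne_zero
      rw [← C_pow, ← map_ev C]
      exact C_ne_zero.mpr hD'
    exact h3 h1.symm
  have hP : ∀ x, chi x 0 = true → WW (z x) (-v) ≠ 0 := by
    intro x hx h
    classical
    have h1 := roots_bound (WP (-v)) hWP
      ((insert x (Finset.univ.filter fun x : Fin 12 => chi x 0 = false)).image z) (by
        intro a ha
        obtain ⟨y, hy, rfl⟩ := Finset.mem_image.mp ha
        rw [WP_eval]
        rcases Finset.mem_insert.mp hy with rfl | hy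
        · exact h
        · exact (hprod y).resolve_left (hN y (Finset.mem_filter.mp hy).2))
    rw [Finset.card_image_of_injective _ hzi, Finset.card_insert_of_notMem (by simp [hx]),
      chi_zero_card] at h1
    have := WP_natDegree (-v)
    lia
  have h0 : ∀ x, (WW (z x) v = 0 ↔ chi x 0 = true) ∧ (WW (z x) (-v) = 0 ↔ chi x 0 = false) := by
    intro x
    have a := hprod x
    have b := hN x
    have c := hP x
    clear hprod hN hP hWP hD hD' hW hzr hzs hzθ hφ hs hR
    cases hc : chi x 0
    · simp only [hc, Bool.false_eq_true, iff_true, iff_false] at *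
      exact ⟨b trivial, a.resolve_left (b trivial)⟩
    · simp only [hc, reduceCtorEq, iff_true, iff_false] at *
      exact ⟨a.resolve_right (c trivial), c trivial⟩
  let u : Fin 11 × Bool → 𝓞 E := fun q => φ ^ q.1.val • (if q.2 then v else -v)
  have hu : ∀ q x, WW (z x) (u q) = 0 ↔ chi x q.1 = q.2 := by
    intro q x
    obtain ⟨h1, h2⟩ := chi_sh x q.1
    have h3 : z x = φ ^ q.1.val • z (sh (11 - q.1.val) x) := by rw [hzs, h2]
    rw [h3, smul_WW, smul_eq_zero_iff_eq, ← h1]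
    have h4 := h0 (sh (11 - q.1.val) x)
    cases q.2
    · simpa using h4.2
    · simpa using h4.1
  have hur : ∀ q, em (u q) RL22 = 0 := by
    intro q
    simp only [u, smul_em]
    split
    · rw [hv, smul_zero]
    · rw [hvn, smul_zero]
  have hui : Function.Injective u := by
    intro q q' h
    apply chi_pat
    intro x
    rw [← hu, ← hu, h]
  refine ⟨z, hzi, hzr, ?_, ?_⟩
  · intro j hj
    refine ⟨φ ^ j.val, ?_⟩
    rw [hzs]
    congr 1
    simp [sh, Nat.mod_eq_of_lt hj]
  · intro τ π hπ
    have hex : ∀ j : Fin 11, ∃ q, u q = τ • u (j, true) := fun j =>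
      em_all RL22 rfl (by simp [RL22]) u hui hur _ (by rw [smul_em, hur, smul_zero])
    choose q hq using hex
    have key : ∀ x j, chi x j = true ↔ chi (π x) (q j).1 = (q j).2 := by
      intro x j
      rw [← hu (j, true) x, ← hu (q j) (π x), hq, ← hπ, smul_WW, smul_eq_zero_iff_eq]
    have key2 : ∀ x x' j, (chi x j == chi x' j) =
        (chi (π x) (q j).1 == chi (π x') (q j).1) := by
      intro x x' j
      exact bool_aux _ _ _ _ _ (key x j) (key x' j)
    have hqi : Function.Injective fun j => (q j).1 := by
      intro j j' h
      simp only at h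
      apply chi_rig2
      intro x x'
      rw [key2, key2 x x' j', h]
    refine ⟨Equiv.ofBijective _ (Finite.injective_iff_bijective.mp hqi), ?_⟩
    rw [mem_MM]
    exact key2
end lab
end M11P
namespace M11P
open Polynomial NumberField

theorem pc59 : okPer 59 f59 i59 b59 11 1 = true := by decide +kernel

theorem f4_eval {K : Type*} [Field K] [Algebra ℚ K] (r : K) :
    4 ^ 12 * aeval r f4 = em (4 * r) FL := by
  have : CharZero K := algebraRat.charZero K
  simp only [f4, map_sub, map_mul, map_pow, aeval_X, aeval_C, map_one, map_ofNat, em, ev, FL,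
    List.length, map_div₀]
  push_cast
  field_simp
  ring

theorem f4_comp : f4 = C (1 / 4 ^ 12) * (em (X : ℚ[X]) FL).comp (C 4 * X) := by
  refine Polynomial.funext fun q => ?_
  have h := f4_eval q
  rw [coe_aeval_eq_eval] at h
  simp only [eval_mul, eval_comp, eval_C, eval_X, emX_eval]
  rw [← h]; ring

theorem f4_natDegree : f4.natDegree = 12 := by
  rw [f4_comp, natDegree_C_mul (by norm_num), natDegree_comp, emX_natDegree,
    natDegree_C_mul_X _ (by norm_num)]
  rfl

theorem f4_ne : f4 ≠ 0 := by
  intro h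
  have := f4_natDegree
  rw [h] at this
  simp at this

theorem f4_no_root (c : ℚ) : f4.eval c ≠ 0 := by
  intro h
  have h1 := f4_eval c
  rw [coe_aeval_eq_eval, h, mul_zero] at h1
  have h2 : IsIntegral ℤ (4 * c) := by
    refine ⟨em X FL, emX_monic FL, ?_⟩
    have := map_em (eval₂RingHom (algebraMap ℤ ℚ) (4 * c)) X FL
    simp only [coe_eval₂RingHom, eval₂_X] at this
    rw [this, ← h1]
  obtain ⟨n, hn⟩ := IsIntegrallyClosed.algebraMap_eq_of_integral h2
  rw [← hn, ← map_em] at h1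
  have h3 : em n FL = 0 := by
    have := h1.symm
    simpa using this
  have h4 := map_em (Int.castRingHom (ZMod 7)) n FL
  rw [h3, map_zero] at h4
  have h5 : ∀ m : ZMod 7, m ^ 12 + ((((((((((((-24 * m + 159) * m - 910) * m + 8520) * m - 56544) * m
      + 350336) * m - 1990656) * m + 6635520) * m - 10403840) * m + 4521984) * m + 5505024) * m)
      + 1048576) ≠ 0 := by decide +kernel
  apply h5 ((Int.castRingHom (ZMod 7)) n)
  rw [h4]
  simp only [em, ev, FL, List.length]
  push_cast
  ring

section fin
variable {E : Type} [Field E] [NumberField E] [IsGalois ℚ E]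

theorem f4_splits (hs : (em (X : E[X]) FL).Splits) : (f4.map (algebraMap ℚ E)).Splits := by
  have h : (em (X : ℚ[X]) FL).map (algebraMap ℚ E) = em X FL := by
    have := map_em (mapRingHom (algebraMap ℚ E)) X FL
    simpa using this
  rw [f4_comp, Polynomial.map_mul, map_comp, h, map_C]
  refine Splits.C_mul (hs.comp_of_natDegree_le_one ?_) _
  rw [Polynomial.map_mul, map_C, map_X]
  exact (natDegree_C_mul_le _ _).trans natDegree_X_le

theorem mem_roots_f4 (r : E) : r ∈ f4.rootSet E ↔ em (4 * r) FL = 0 := by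
  rw [mem_rootSet, ← f4_eval]
  simp [f4_ne]

theorem em_coe (z : 𝓞 E) (r : List ℤ) : em (z : E) r = 0 ↔ em z r = 0 := by
  rw [← map_em (algebraMap (𝓞 E) E)]
  simp

theorem cert_dvd (hs : (em (X : E[X]) FL).Splits) (n : ℕ)
    (h : ∃ (φ : E ≃ₐ[ℚ] E) (z : 𝓞 E), em z FL = 0 ∧ ∀ m, φ ^ m • z = z → n ∣ m) :
    n ∣ Nat.card f4.Gal := by
  have : Fact ((f4.map (algebraMap ℚ E)).Splits) := ⟨f4_splits hs⟩
  obtain ⟨φ, z, hz, hn⟩ := h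
  have h1 : n ∣ orderOf (Gal.restrict f4 E φ) := by
    apply hn
    have h2 : Gal.restrict f4 E (φ ^ orderOf (Gal.restrict f4 E φ)) = 1 := by
      rw [map_pow, pow_orderOf_eq_one]
    have hr : (z : E) / 4 ∈ f4.rootSet E := by
      rw [mem_roots_f4, mul_div_cancel₀ _ (by norm_num), em_coe, hz]
    have h3 := Gal.restrict_smul (φ ^ orderOf (Gal.restrict f4 E φ)) ⟨_, hr⟩
    rw [h2, one_smul] at h3
    simp only [map_div₀, map_ofNat] at h3
    apply RingOfIntegers.ext
    change (φ ^ orderOf (Gal.restrict f4 E φ)) (z : E) = z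
    field_simp at h3
    exact h3.symm
  exact h1.trans (orderOf_dvd_natCard _)

theorem card_dvd (hs : (em (X : E[X]) FL).Splits) : 1320 ∣ Nat.card f4.Gal := by
  have h1 := cert_dvd hs _ (period_cert hs 7 (by norm_num) 2 2 (by norm_num) f7 g7 i7 (by decide) oF7
    b7 rfl pc7)
  have h2 := cert_dvd hs _ (period_cert hs 11 (by norm_num) 3 0 (by norm_num) f11 g11 i11 (by decide) oF11
    b11 rfl pc11)
  have h3 := cert_dvd hs _ (period_cert hs 53 (by norm_num) 5 0 (by norm_num) f53 g53 i53 (by decide) oF53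
    b53 rfl pc53)
  have h4 := cert_dvd hs _ (period_cert hs 59 (by norm_num) 11 0 (by norm_num) f59 g59 i59 (by decide) oF59
    b59 rfl pc59)
  generalize Nat.card f4.Gal = n at *
  norm_num at h1 h2 h3 h4
  lia

theorem f4_irred (z : Fin 12 → 𝓞 E) (hzi : Function.Injective z) (hzr : ∀ i, em (z i) FL = 0)
    (htr : ∀ j : Fin 12, j.val < 11 → ∃ τ : E ≃ₐ[ℚ] E, τ • z 0 = z j) : Irreducible f4 := by
  classical
  set r : E := (z 0 : E) / 4 with hr
  have hint : IsIntegral ℚ r := Algebra.IsIntegral.isIntegral r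
  have hroot : aeval r f4 = 0 := by
    have : r ∈ f4.rootSet E := by
      rw [mem_roots_f4, hr, mul_div_cancel₀ _ (by norm_num), em_coe, hzr]
    exact (mem_rootSet.mp this).2
  obtain ⟨g, hg⟩ := minpoly.dvd ℚ r hroot
  have hdeg : 11 ≤ (minpoly ℚ r).natDegree := by
    have hne : (minpoly ℚ r).map (algebraMap ℚ E) ≠ 0 :=
      ((minpoly.monic hint).map _).ne_zero
    have h := roots_bound _ hne
      ((Finset.univ : Finset (Fin 11)).image fun j => (z j.castSucc : E) / 4) (by
        intro a ha
        obtain ⟨j, -, rfl⟩ := Finset.mem_image.mp ha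
        obtain ⟨τ, hτ⟩ := htr j.castSucc (by simp)
        rw [eval_map_algebraMap, ← hτ]
        have h2 : ((τ • z 0 : 𝓞 E) : E) / 4 = τ r := by
          rw [hr, map_div₀, map_ofNat]; rfl
        rw [h2]
        have h3 := aeval_algHom_apply τ.toAlgHom r (minpoly ℚ r)
        rw [minpoly.aeval, map_zero] at h3
        exact h3)
    rw [natDegree_map, Finset.card_image_of_injective, Finset.card_univ, Fintype.card_fin] at h
    · exact h
    · intro i j hij
      simp only at hij
      have h5 : (z i.castSucc : E) = z j.castSucc := by
        field_simp at hij
        exact hij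
      exact Fin.castSucc_injective _ (hzi (RingOfIntegers.ext h5))
  have hg0 : g ≠ 0 := by
    rintro rfl
    exact f4_ne (by rw [hg, mul_zero])
  have hsum := natDegree_mul (minpoly.ne_zero hint) hg0
  rw [← hg, f4_natDegree] at hsum
  have hg1 : g.natDegree ≠ 1 := by
    intro h1
    obtain ⟨c, hc⟩ := exists_root_of_degree_eq_one (degree_eq_iff_natDegree_eq hg0 |>.mpr h1)
    apply f4_no_root c
    rw [hg, eval_mul, hc.eq_zero, mul_zero]
  have hg2 : IsUnit g := by
    rw [isUnit_iff_degree_eq_zero, degree_eq_natDegree hg0]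
    have : g.natDegree = 0 := by lia
    rw [this]; rfl
  rw [hg, irreducible_mul_isUnit hg2]
  exact minpoly.irreducible hint

theorem gal_hom (hs : (em (X : E[X]) FL).Splits) (z : Fin 12 → 𝓞 E) (hzi : Function.Injective z)
    (hzr : ∀ i, em (z i) FL = 0)
    (hM : ∀ (τ : E ≃ₐ[ℚ] E) (π : Equiv.Perm (Fin 12)), (∀ i, τ • z i = z (π i)) →
        ∃ ρ : Equiv.Perm (Fin 11), (π, ρ) ∈ MM) :
    ∃ Φ : f4.Gal →* Equiv.Perm (Fin 12), Function.Injective Φ ∧ ∀ σ, ∃ m : MM, m.1.1 = Φ σ := by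
  have : Fact ((f4.map (algebraMap ℚ E)).Splits) := ⟨f4_splits hs⟩
  let e0 : Fin 12 → f4.rootSet E := fun i => ⟨(z i : E) / 4, by
    rw [mem_roots_f4, mul_div_cancel₀ _ (by norm_num), em_coe, hzr]⟩
  have he : Function.Bijective e0 := by
    constructor
    · intro i j hij
      have h1 : (z i : E) / 4 = (z j : E) / 4 := congrArg Subtype.val hij
      field_simp at h1
      exact hzi (RingOfIntegers.ext h1)
    · rintro ⟨r, hr⟩
      rw [mem_roots_f4] at hr
      obtain ⟨i, hi⟩ := em_all FL rfl (by simp [FL]) (fun i => (z i : E))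
        (fun i j h => hzi (RingOfIntegers.ext h)) (fun i => (em_coe _ _).mpr (hzr i)) _ hr
      refine ⟨i, Subtype.ext ?_⟩
      change (z i : E) / 4 = r
      rw [hi]; field_simp
  let e := Equiv.ofBijective e0 he
  let Φ : f4.Gal →* Equiv.Perm (Fin 12) :=
    (e.symm.permCongrHom).toMonoidHom.comp (Gal.galActionHom f4 E)
  refine ⟨Φ, ?_, ?_⟩
  · exact (e.symm.permCongrHom).injective.comp (Gal.galActionHom_injective f4 E)
  · intro σ
    obtain ⟨τ, rfl⟩ := Gal.restrict_surjective f4 E σ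
    have key : ∀ i, τ • z i = z (Φ (Gal.restrict f4 E τ) i) := by
      intro i
      have h1 : e (Φ (Gal.restrict f4 E τ) i) = Gal.galActionHom f4 E (Gal.restrict f4 E τ) (e i) := by
        simp [Φ, Equiv.permCongrHom]
      have h2 := congrArg Subtype.val h1
      rw [Gal.galActionHom_restrict] at h2
      change (z (Φ (Gal.restrict f4 E τ) i) : E) / 4 = τ ((z i : E) / 4) at h2
      rw [map_div₀, map_ofNat] at h2
      field_simp at h2
      exact RingOfIntegers.ext h2.symm
    obtain ⟨ρ, hρ⟩ := hM τ _ key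
    exact ⟨⟨_, hρ⟩, rfl⟩
end fin

theorem group_final {G : Type*} [Group G] (Φ : G →* Equiv.Perm (Fin 12)) (hΦ : Function.Injective Φ)
    (h : ∀ σ, ∃ m : MM, m.1.1 = Φ σ) (hd : 1320 ∣ Nat.card G) : Nonempty (G ≃* MM) := by
  let q : MM →* Equiv.Perm (Fin 12) := (MonoidHom.fst _ _).comp MM.subtype
  have hq : Function.Injective q := by
    rw [injective_iff_map_eq_one]
    intro a ha
    exact Subtype.ext (MM_fst a.2 ha)
  choose ψ hψ using h
  have hψ' : ∀ σ, q (ψ σ) = Φ σ := hψ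
  let Ψ : G →* MM :=
    { toFun := ψ
      map_one' := hq (by rw [hψ', map_one, map_one])
      map_mul' := fun a b => hq (by rw [hψ', map_mul, map_mul, hψ', hψ']) }
  have hi : Function.Injective Ψ := by
    intro a b hab
    apply hΦ
    rw [← hψ', ← hψ']
    exact congrArg q hab
  have ht : Ψ.range = ⊤ := by
    apply MM_top
    rwa [← Nat.card_congr (MonoidHom.ofInjective hi).toEquiv]
  exact ⟨MulEquiv.ofBijective Ψ ⟨hi, MonoidHom.range_eq_top.mp ht⟩⟩

theorem main_aux (E : Type) [Field E] [NumberField E] [IsGalois ℚ E]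
    (hs : (em (X : E[X]) FL).Splits) (hR : (em (X : E[X]) RL22).Splits) :
    Irreducible f4 ∧ IsSimpleGroup f4.Gal ∧ Nat.card f4.Gal = 7920 := by
  obtain ⟨z, hzi, hzr, htr, hM⟩ := labelling hs hR
  obtain ⟨Φ, hΦ, h⟩ := gal_hom hs z hzi hzr hM
  obtain ⟨e⟩ := group_final Φ hΦ h (card_dvd hs)
  refine ⟨f4_irred z hzi hzr htr, ?_, ?_⟩
  · have := MM_simple
    exact e.isSimpleGroup
  · rw [Nat.card_congr e.toEquiv, card_MM]

noncomputable def PP : ℚ[X] := em X FL * em X RL22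

theorem main_aux2 (E : Type) [Field E] (A : Algebra ℚ E) (hE : IsSplittingField ℚ E PP) :
    Irreducible f4 ∧ IsSimpleGroup f4.Gal ∧ Nat.card f4.Gal = 7920 := by
  have : CharZero E := algebraRat.charZero _
  obtain rfl : A = DivisionRing.toRatAlgebra := Subsingleton.elim _ _
  have : Normal ℚ E := Normal.of_isSplittingField PP
  have : IsGalois ℚ E := {}
  have : FiniteDimensional ℚ E := IsSplittingField.finiteDimensional E PP
  have : NumberField E := {}
  have h := IsSplittingField.splits E PP
  have h2 : ∀ l, (em (X : ℚ[X]) l).map (algebraMap ℚ E) = em X l := by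
    intro l
    have := map_em (mapRingHom (algebraMap ℚ E)) X l
    simpa using this
  have h3 : PP.map (algebraMap ℚ E) = em X FL * em X RL22 := by
    rw [← h2, ← h2, ← Polynomial.map_mul]; rfl
  rw [h3] at h
  have h4 : (em (X : E[X]) FL * em X RL22) ≠ 0 :=
    mul_ne_zero (emX_monic _).ne_zero (emX_monic _).ne_zero
  exact main_aux E (h.of_dvd h4 ⟨_, rfl⟩) (h.of_dvd h4 ⟨_, mul_comm _ _⟩)
end M11P

theorem m11_specialization_grd :
    Irreducible f4 ∧ IsSimpleGroup f4.Gal ∧ Nat.card f4.Gal = 7920 :=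
  M11P.main_aux2 M11P.PP.SplittingField _ (IsSplittingField.splittingField _)
end

section
/- Let f₅(x) = (x² − x − 1)⁵·(x² − x − 1/16) − (81/16)·x³·(x − 1)³·(x³ − 2) ∈ ℚ[x], a monic polynomial of degree 12. Then f₅ is reducible over ℚ; more precisely, f₅ factors over ℚ as a product of two irreducible polynomials, each of degree 6. -/
open Polynomial

/-- `f₅(x) = (x² − x − 1)⁵ (x² − x − 1/16) − (81/16) · x³ (x − 1)³ (x³ − 2)` over `ℚ`. -/
noncomputable def f5 : Polynomial ℚ :=
  (X ^ 2 - X - 1) ^ 5 * (X ^ 2 - X - C (1 / 16 : ℚ)) -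
    C (81 / 16 : ℚ) * (X ^ 3 * (X - 1) ^ 3 * (X ^ 3 - 2))

lemma aux_sextic (P : ℤ[X]) (hd : P.natDegree = 6) (hprim : P.IsPrimitive)
    (h2 : Irreducible (P.map (Int.castRingHom (ZMod 2))))
    (h2d : (P.map (Int.castRingHom (ZMod 2))).natDegree = 5)
    (h3 : ((P.leadingCoeff : ℤ) : ZMod 3) ≠ 0)
    (h3r : ∀ x : ZMod 3, (P.map (Int.castRingHom (ZMod 3))).eval x ≠ 0) : Irreducible P := by
  have key : ∀ a b : ℤ[X], P = a * b →
      IsUnit (b.map (Int.castRingHom (ZMod 2))) → IsUnit b := by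
    intro a b hab hb
    have hP0 : P ≠ 0 := by rintro rfl; simp at hd
    have ha0 : a ≠ 0 := by rintro rfl; simp at hab; exact hP0 hab
    have hb0 : b ≠ 0 := by rintro rfl; simp at hab; exact hP0 hab
    have hdeg : a.natDegree + b.natDegree = 6 := by
      rw [← natDegree_mul ha0 hb0, ← hab, hd]
    have h5 : 5 ≤ a.natDegree := by
      have h1 : (P.map (Int.castRingHom (ZMod 2))).natDegree ≤
          (a.map (Int.castRingHom (ZMod 2))).natDegree +
          (b.map (Int.castRingHom (ZMod 2))).natDegree := by
        rw [hab, Polynomial.map_mul]; exact natDegree_mul_le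
      rw [h2d, natDegree_eq_zero_of_isUnit hb] at h1
      have := natDegree_map_le (f := Int.castRingHom (ZMod 2)) (p := a)
      omega
    have hb1 : b.natDegree = 0 ∨ b.natDegree = 1 := by omega
    rcases hb1 with hb1 | hb1
    · rw [natDegree_eq_zero] at hb1
      obtain ⟨c, rfl⟩ := hb1
      exact (hprim c ⟨a, by rw [hab, mul_comm]⟩).map C
    · exfalso
      have hl : ((b.leadingCoeff : ℤ) : ZMod 3) ≠ 0 := by
        intro h; apply h3; rw [hab, leadingCoeff_mul]; push_cast; rw [h, mul_zero]
      have hc : ((b.coeff 1 : ℤ) : ZMod 3) ≠ 0 := by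
        rw [← hb1]; exact hl
      apply h3r (-(b.coeff 0 : ZMod 3) / (b.coeff 1 : ZMod 3))
      rw [hab, Polynomial.map_mul, eval_mul]
      have hbb : b = C (b.coeff 1) * X + C (b.coeff 0) :=
        eq_X_add_C_of_natDegree_le_one (by omega)
      have : (b.map (Int.castRingHom (ZMod 3))).eval
          (-(b.coeff 0 : ZMod 3) / (b.coeff 1 : ZMod 3)) = 0 := by
        generalize b.coeff 1 = u at *
        generalize b.coeff 0 = v at *
        subst hbb
        simp only [Polynomial.map_add, Polynomial.map_mul, map_C, map_X, eval_add, eval_mul, eval_C, eval_X]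
        simp only [eq_intCast]
        rw [mul_div_cancel₀ _ hc]
        ring
      rw [this, mul_zero]
  constructor
  · intro h
    have := natDegree_eq_zero_of_isUnit h
    omega
  · intro a b hab
    have := h2.isUnit_or_isUnit (a := a.map (Int.castRingHom (ZMod 2)))
      (b := b.map (Int.castRingHom (ZMod 2))) (by rw [hab, Polynomial.map_mul])
    rcases this with h | h
    · left; exact key b a (by rw [hab, mul_comm]) h
    · right; exact key a b hab h

lemma aux_quintic (p r s : (ZMod 2)[X]) (hm : p.Monic) (hd : p.natDegree = 5)
    (hr : ∀ x : ZMod 2, p.eval x ≠ 0) (hs0 : s ≠ 0) (hs : s.natDegree ≤ 1)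
    (hp : p = (X ^ 2 + X + 1) * r + s) : Irreducible p := by
  rw [hm.irreducible_iff_lt_natDegree_lt (by rintro rfl; simp at hd)]
  intro q hq hqd hdvd
  have hqr : ∀ x : ZMod 2, q.eval x ≠ 0 := by
    intro x hx
    obtain ⟨t, rfl⟩ := hdvd
    exact hr x (by simp [hx])
  rw [hd, Finset.mem_Ioc] at hqd
  have h12 : q.natDegree = 1 ∨ q.natDegree = 2 := by omega
  rcases h12 with h | h
  · have hc : q.coeff 1 = 1 := by rw [← h]; exact hq
    have hqq := eq_X_add_C_of_natDegree_le_one (p := q) (by omega)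
    apply hqr (-(q.coeff 0))
    rw [hc] at hqq
    generalize q.coeff 0 = v at *
    subst hqq
    simp only [eval_add, eval_mul, eval_C, eval_X]; ring
  · have hc : q.coeff 2 = 1 := by
      have h' := hq.coeff_natDegree
      rwa [h] at h'
    have hqq : q = C (q.coeff 2) * X ^ 2 + C (q.coeff 1) * X + C (q.coeff 0) :=
      eq_quadratic_of_degree_le_two (natDegree_le_iff_degree_le.mp h.le)
    have h0 := hqr 0
    have h1 := hqr 1
    rw [hqq, hc] at h0 h1
    simp at h0 h1
    have : ∀ u v : ZMod 2, u ≠ 0 → 1 + v + u ≠ 0 → u = 1 ∧ v = 1 := by decide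
    obtain ⟨e0, e1⟩ := this _ _ h0 h1
    rw [e0, e1, hc] at hqq
    have hq' : q = X ^ 2 + X + 1 := by rw [hqq]; simp
    have hsd : q ∣ s := by
      rw [hp, ← hq'] at hdvd
      exact (dvd_add_right (dvd_mul_right q r)).mp hdvd
    have := natDegree_le_of_dvd hsd hs0
    omega

lemma aux_P : Irreducible (4 * X ^ 6 - 21 * X ^ 5 + 30 * X ^ 4 - 13 * X ^ 3 + 6 * X ^ 2 - 6 * X - 1 : ℤ[X]) := by
  have hd : (4 * X ^ 6 - 21 * X ^ 5 + 30 * X ^ 4 - 13 * X ^ 3 + 6 * X ^ 2 - 6 * X - 1 : ℤ[X]).natDegree = 6 := by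
    compute_degree!
  have e2 : (4 * X ^ 6 - 21 * X ^ 5 + 30 * X ^ 4 - 13 * X ^ 3 + 6 * X ^ 2 - 6 * X - 1 : ℤ[X]).map
      (Int.castRingHom (ZMod 2)) = X ^ 5 + X ^ 3 + 1 := by
    have h : (2 : (ZMod 2)[X]) = 0 := CharTwo.two_eq_zero
    simp
    linear_combination (2 * X ^ 6 - 11 * X ^ 5 + 15 * X ^ 4 - 7 * X ^ 3 + 3 * X ^ 2 - 3 * X - 1) * h
  have d2 : (X ^ 5 + X ^ 3 + 1 : (ZMod 2)[X]).natDegree = 5 := by compute_degree!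
  apply aux_sextic _ hd
  · intro c hc
    rw [C_dvd_iff_dvd_coeff] at hc
    have := hc 0
    simp at this
    exact isUnit_of_dvd_one (by simpa using this)
  · rw [e2]
    apply aux_quintic _ (X ^ 3 + X ^ 2 + X) (X + 1) (by monicity!) d2
    · simp; decide
    · exact X_add_C_ne_zero 1
    · compute_degree
    · have h : (2 : (ZMod 2)[X]) = 0 := CharTwo.two_eq_zero
      linear_combination (- X ^ 4 - X ^ 3 - X ^ 2 - X) * h
  · rw [e2, d2]
  · rw [leadingCoeff, hd]
    simp [coeff_X, coeff_one, coeff_ofNat_mul, coeff_X_pow]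
    decide
  · simp; decide

lemma aux_Q : Irreducible (4 * X ^ 6 - 3 * X ^ 5 - 6 * X ^ 4 + 5 * X ^ 3 + 15 * X ^ 2 - 15 * X - 1 : ℤ[X]) := by
  have hd : (4 * X ^ 6 - 3 * X ^ 5 - 6 * X ^ 4 + 5 * X ^ 3 + 15 * X ^ 2 - 15 * X - 1 : ℤ[X]).natDegree = 6 := by
    compute_degree!
  have e2 : (4 * X ^ 6 - 3 * X ^ 5 - 6 * X ^ 4 + 5 * X ^ 3 + 15 * X ^ 2 - 15 * X - 1 : ℤ[X]).map
      (Int.castRingHom (ZMod 2)) = X ^ 5 + X ^ 3 + X ^ 2 + X + 1 := by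
    have h : (2 : (ZMod 2)[X]) = 0 := CharTwo.two_eq_zero
    simp
    linear_combination (2 * X ^ 6 - 2 * X ^ 5 - 3 * X ^ 4 + 2 * X ^ 3 + 7 * X ^ 2 - 8 * X - 1) * h
  have d2 : (X ^ 5 + X ^ 3 + X ^ 2 + X + 1 : (ZMod 2)[X]).natDegree = 5 := by compute_degree!
  apply aux_sextic _ hd
  · intro c hc
    rw [C_dvd_iff_dvd_coeff] at hc
    have := hc 0
    simp at this
    exact isUnit_of_dvd_one (by simpa using this)
  · rw [e2]
    apply aux_quintic _ (X ^ 3 + X ^ 2 + X + 1) (X) (by monicity!) d2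
    · simp; decide
    · exact X_ne_zero
    · compute_degree
    · have h : (2 : (ZMod 2)[X]) = 0 := CharTwo.two_eq_zero
      linear_combination (- X ^ 4 - X ^ 3 - X ^ 2 - X) * h
  · rw [e2, d2]
  · rw [leadingCoeff, hd]
    simp [coeff_X, coeff_one, coeff_ofNat_mul, coeff_X_pow]
    decide
  · simp; decide

lemma aux_lift (P : ℤ[X]) (hP : Irreducible P) (hd : P.natDegree = 6) :
    Irreducible (C (1 / 4 : ℚ) * P.map (Int.castRingHom ℚ)) ∧
    (C (1 / 4 : ℚ) * P.map (Int.castRingHom ℚ)).natDegree = 6 := by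
  have hprim : P.IsPrimitive := hP.isPrimitive (by omega)
  constructor
  · have hu : IsUnit (C (1 / 4 : ℚ)) := isUnit_C.mpr (by norm_num)
    rw [irreducible_isUnit_mul hu]
    exact (IsPrimitive.Int.irreducible_iff_irreducible_map_cast hprim).mp hP
  · rw [natDegree_C_mul (by norm_num), natDegree_map_eq_of_injective (Int.cast_injective), hd]

theorem f5_splits_into_two_sextics :
    f5.Monic ∧ f5.natDegree = 12 ∧
    ¬ Irreducible f5 ∧
    ∃ p q : Polynomial ℚ, Irreducible p ∧ Irreducible q ∧
      p.natDegree = 6 ∧ q.natDegree = 6 ∧ f5 = p * q := by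
  obtain ⟨hp, hpd⟩ := aux_lift _ aux_P (by compute_degree!)
  obtain ⟨hq, hqd⟩ := aux_lift _ aux_Q (by compute_degree!)
  have hf : f5 = (C (1 / 4 : ℚ) * Polynomial.map (Int.castRingHom ℚ) (4 * X ^ 6 - 21 * X ^ 5 + 30 * X ^ 4 - 13 * X ^ 3 + 6 * X ^ 2 - 6 * X - 1 : ℤ[X])) * (C (1 / 4 : ℚ) * Polynomial.map (Int.castRingHom ℚ) (4 * X ^ 6 - 3 * X ^ 5 - 6 * X ^ 4 + 5 * X ^ 3 + 15 * X ^ 2 - 15 * X - 1 : ℤ[X])) := by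
    have h4 : (C (1 / 4 : ℚ)) = 4 * C (1 / 16 : ℚ) := by
      rw [show (4 : ℚ[X]) = C 4 from rfl, ← C_mul]; norm_num
    have h81 : (C (81 / 16 : ℚ)) = 81 * C (1 / 16 : ℚ) := by
      rw [show (81 : ℚ[X]) = C 81 from rfl, ← C_mul]; norm_num
    have h16 : 16 * C (1 / 16 : ℚ) = 1 := by
      rw [show (16 : ℚ[X]) = C 16 from rfl, ← C_mul]; norm_num
    unfold f5
    rw [h4, h81]
    simp only [Polynomial.map_add, Polynomial.map_sub, Polynomial.map_mul, Polynomial.map_pow,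
      Polynomial.map_ofNat, Polynomial.map_one, map_X]
    generalize C (1 / 16 : ℚ) = c at *
    linear_combination (-(X ^ 2 - X) * (X ^ 2 - X - 1) ^ 5
      - c * (4 * X ^ 6 - 21 * X ^ 5 + 30 * X ^ 4 - 13 * X ^ 3 + 6 * X ^ 2 - 6 * X - 1) * (4 * X ^ 6 - 3 * X ^ 5 - 6 * X ^ 4 + 5 * X ^ 3 + 15 * X ^ 2 - 15 * X - 1)) * h16
  refine ⟨?_, ?_, ?_, _, _, hp, hq, hpd, hqd, hf⟩
  · unfold f5; monicity!
  · rw [hf, natDegree_mul hp.ne_zero hq.ne_zero, hpd, hqd]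
  · intro h
    rcases h.isUnit_or_isUnit hf with h | h
    · exact hp.not_isUnit h
    · exact hq.not_isUnit h
end
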